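/- arXiv:2307.13535 — 2 statements merged into one kernel-verified Lean document; each statement's English description precedes it below -/
import Mathlib

section
/- There exist a universal constant c > 0 and an integer k₀ such that the following holds. Let d = 2^h − 1 with d ≥ k², let k ≥ k₀, and let λ > 0, n ≥ 1. Then for every measurable estimator v̂ : (ℝ^d)^n → ℝ^d there exists a k-tree-sparse unit vector v* ∈ S^{d−1} such that, with x_1, …, x_n the spiked Wishart samples with spike v*, E[‖v̂(x_1,…,x_n) v̂(x_1,…,x_n)ᵀ − v* v*ᵀ‖_F] ≥ c · min{ 1/(4√(log k)) , (1/4)·√((1+λ)/(8λ²)) · √( (k/log k) / n ) }. -/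
open MeasureTheory ProbabilityTheory Matrix Finset

noncomputable section

namespace StructuredPCA

/-- Euclidean inner product on `Fin d → ℝ`. -/
def ip {d : ℕ} (u v : Fin d → ℝ) : ℝ := ∑ i, u i * v i

/-- Euclidean norm on `Fin d → ℝ`. -/
def nrm {d : ℕ} (v : Fin d → ℝ) : ℝ := Real.sqrt (∑ i, v i ^ 2)

/-- Quadratic form `vᵀ A v`. -/
def quad {d : ℕ} (A : Matrix (Fin d) (Fin d) ℝ) (v : Fin d → ℝ) : ℝ := ip v (A.mulVec v)

/-- `ρ(A, S) = sup { |vᵀ A v| : v ∈ S, ‖v‖ = 1 }`. -/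
def rho {d : ℕ} (A : Matrix (Fin d) (Fin d) ℝ) (S : Set (Fin d → ℝ)) : ℝ :=
  sSup {x : ℝ | ∃ v ∈ S, nrm v = 1 ∧ x = |quad A v|}

/-- Frobenius norm of a matrix. -/
def frob {d : ℕ} (A : Matrix (Fin d) (Fin d) ℝ) : ℝ :=
  Real.sqrt (∑ i, ∑ j, A i j ^ 2)

/-- Operator (spectral) norm of a matrix. -/
def opNorm {d : ℕ} (A : Matrix (Fin d) (Fin d) ℝ) : ℝ :=
  sSup {x : ℝ | ∃ v, nrm v = 1 ∧ x = nrm (A.mulVec v)}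

/-- The spiked covariance `λ v* v*ᵀ + I`. -/
def spikedCov {d : ℕ} (lam : ℝ) (vstar : Fin d → ℝ) : Matrix (Fin d) (Fin d) ℝ :=
  lam • vecMulVec vstar vstar + 1

/-- `x 1, …, x n` are spiked Wishart samples with spike `v*`:
`x i = √λ g i • v* + z i` with `g, z` i.i.d. standard normal, mutually independent. -/
def IsSpikedWishart {d n : ℕ} {Ω : Type*} [MeasurableSpace Ω] (μ : Measure Ω)
    (lam : ℝ) (vstar : Fin d → ℝ) (x : Fin n → Ω → Fin d → ℝ) : Prop :=
  ∃ G : (Fin n ⊕ Fin n × Fin d) → Ω → ℝ,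
    (∀ i, Measurable (G i)) ∧
    iIndepFun G μ ∧
    (∀ i, μ.map (G i) = gaussianReal 0 1) ∧
    ∀ i ω j, x i ω j = Real.sqrt lam * G (Sum.inl i) ω * vstar j + G (Sum.inr (i, j)) ω

/-- The sample covariance matrix `n⁻¹ ∑ xᵢ xᵢᵀ`. -/
def sampleCov {d n : ℕ} {Ω : Type*} (x : Fin n → Ω → Fin d → ℝ) (ω : Ω) :
    Matrix (Fin d) (Fin d) ℝ :=
  (n : ℝ)⁻¹ • ∑ i, vecMulVec (x i ω) (x i ω)

/-- Union-of-linear-structures data: an orthonormal basis `φ` and subsets `Bs m`. -/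
structure UnionStruct (d M : ℕ) where
  φ : Fin d → Fin d → ℝ
  orthonormal : ∀ i j, ip (φ i) (φ j) = if i = j then 1 else 0
  Bs : Fin M → Finset (Fin d)

/-- The subspace `L m = span (B m)`. -/
def UnionStruct.L {d M : ℕ} (U : UnionStruct d M) (m : Fin M) : Submodule ℝ (Fin d → ℝ) :=
  Submodule.span ℝ (U.φ '' (U.Bs m : Set (Fin d)))

/-- The union `𝓜 = ⋃ m, L m`. -/
def UnionStruct.carrier {d M : ℕ} (U : UnionStruct d M) : Set (Fin d → ℝ) :=
  ⋃ m, (U.L m : Set (Fin d → ℝ))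

/-- A `(d,k)`-layered graph. -/
structure LayeredGraph (d k : ℕ) where
  vs : Fin d
  vt : Fin d
  hst : vs ≠ vt
  V : Fin k → Finset (Fin d)
  hvs : ∀ j, vs ∉ V j
  hvt : ∀ j, vt ∉ V j
  hdisj : ∀ j j', j ≠ j' → Disjoint (V j) (V j')
  hdvd : k ∣ (d - 2)
  hcard : ∀ j, (V j).card = (d - 2) / k
  hcover : ∀ i, i ≠ vs → i ≠ vt → ∃ j, i ∈ V j

/-- A member of `P^k`: contains `v_s`, `v_t` and exactly one vertex of each layer. -/
def LayeredGraph.IsPathSet {d k : ℕ} (G : LayeredGraph d k) (P : Finset (Fin d)) : Prop :=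
  G.vs ∈ P ∧ G.vt ∈ P ∧ ∀ j, (P ∩ G.V j).card = 1

/-- `v` is `k`-path-sparse. -/
def LayeredGraph.PathSparse {d k : ℕ} (G : LayeredGraph d k) (v : Fin d → ℝ) : Prop :=
  ∃ P, G.IsPathSet P ∧ ∀ i, v i ≠ 0 → i ∈ P

/-- A member of `T^k`: a `k`-element rooted connected subtree of the complete binary
tree on nodes `1, …, d` (node `i ≥ 2` has parent `i / 2`). -/
def IsTreeSet (d k : ℕ) (T : Finset ℕ) : Prop :=
  T.card = k ∧ 1 ∈ T ∧ (∀ i ∈ T, 1 ≤ i ∧ i ≤ d) ∧ ∀ i ∈ T, 2 ≤ i → i / 2 ∈ T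

/-- `v` is `k`-tree-sparse (coordinate `i : Fin d` corresponds to node `i + 1`). -/
def TreeSparse (d k : ℕ) (v : Fin d → ℝ) : Prop :=
  ∃ T, IsTreeSet d k T ∧ ∀ i : Fin d, v i ≠ 0 → (i : ℕ) + 1 ∈ T

/-- The index of the parent node: coordinate `i` is node `i+1`, whose parent is `(i+1)/2`. -/
def parentIdx {d : ℕ} (i : Fin d) : Fin d :=
  ⟨((i : ℕ) + 1) / 2 - 1, by have := i.isLt; omega⟩

/-- The feasible set of the SDP relaxation for tree-sparse PCA. -/
def sdpFeasible (d k : ℕ) : Set (Matrix (Fin d) (Fin d) ℝ) :=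
  {Mm | Mm.PosSemidef ∧ (∑ i, Mm i i) = 1 ∧ (∑ i, ∑ j, |Mm i j|) ≤ (k : ℝ) ∧
    ∀ i : Fin d, 2 ≤ (i : ℕ) + 1 → Mm i i ≤ Mm (parentIdx i) (parentIdx i)}


/-- The standard Gaussian product measure. -/
abbrev gam (ι : Type) [Fintype ι] : Measure (ι → ℝ) := Measure.pi (fun _ : ι => gaussianReal 0 1)

lemma gauss1 (b c : ℝ) (hc : c < 1 / 2) :
    ∫⁻ x, ENNReal.ofReal (Real.exp (b * x + c * x ^ 2)) ∂(gaussianReal 0 1)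
      = ENNReal.ofReal (Real.exp (b ^ 2 / (2 * (1 - 2 * c))) / Real.sqrt (1 - 2 * c)) := by
  have hs : 0 < 1 - 2 * c := by linarith
  rw [gaussianReal_of_var_ne_zero _ one_ne_zero,
    lintegral_withDensity_eq_lintegral_mul _ (measurable_gaussianPDF _ _) (by fun_prop)]
  obtain ⟨v, hvv⟩ : ∃ v : NNReal, (v : ℝ) = (1 - 2 * c)⁻¹ :=
    ⟨Real.toNNReal (1 - 2 * c)⁻¹, Real.coe_toNNReal _ (by positivity)⟩
  have hv : v ≠ 0 := by
    rintro rfl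
    simp only [NNReal.coe_zero] at hvv
    have : 0 < (1 - 2 * c)⁻¹ := by positivity
    linarith
  have key : ∀ x, (gaussianPDF 0 1 * fun x => ENNReal.ofReal (Real.exp (b * x + c * x ^ 2))) x
      = ENNReal.ofReal (Real.exp (b ^ 2 / (2 * (1 - 2 * c))) / Real.sqrt (1 - 2 * c)) *
        gaussianPDF (b / (1 - 2 * c)) v x := by
    intro x
    simp only [Pi.mul_apply, gaussianPDF, gaussianPDFReal]
    rw [← ENNReal.ofReal_mul (by positivity), ← ENNReal.ofReal_mul (by positivity)]
    congr 1
    have e1 : Real.sqrt (2 * Real.pi * (1 - 2 * c)⁻¹)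
        = Real.sqrt (2 * Real.pi) / Real.sqrt (1 - 2 * c) := by
      rw [← div_eq_mul_inv, Real.sqrt_div (by positivity)]
    have h1 : Real.sqrt (1 - 2 * c) ≠ 0 := by positivity
    have h2 : Real.sqrt (2 * Real.pi) ≠ 0 := by positivity
    simp only [hvv, NNReal.coe_one, mul_one, e1, sub_zero]
    rw [mul_assoc, ← Real.exp_add]
    have : -x ^ 2 / 2 + (b * x + c * x ^ 2) = b ^ 2 / (2 * (1 - 2 * c)) +
       -(x - b / (1 - 2 * c)) ^ 2 / (2 * (1 - 2 * c)⁻¹) := by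
      field_simp
      ring
    rw [this, Real.exp_add]
    field_simp
  simp_rw [key]
  rw [lintegral_const_mul _ (measurable_gaussianPDF _ _), lintegral_gaussianPDF_eq_one _ hv, mul_one]

lemma lint_prod {ι : Type} [Fintype ι] (f : ι → ℝ → ENNReal) (hf : ∀ i, Measurable (f i)) :
    ∫⁻ z, ∏ i, f i (z i) ∂(gam ι) = ∏ i, ∫⁻ x, f i x ∂(gaussianReal 0 1) := by
  have h := iIndepFun_pi (μ := fun _ : ι => gaussianReal 0 1) (X := f)
    (fun i => (hf i).aemeasurable)
  rw [lintegral_prod_eq_prod_lintegral_of_indepFun univ (fun i (ω : ι → ℝ) => f i (ω i)) h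
    (fun i => (hf i).comp (measurable_pi_apply i))]
  refine Finset.prod_congr rfl fun i _ => ?_
  rw [← (measurePreserving_eval (fun _ : ι => gaussianReal 0 1) i).lintegral_comp (hf i)]

lemma gpi {ι : Type} [Fintype ι] (b c : ι → ℝ) (hc : ∀ i, c i < 1 / 2) :
    ∫⁻ z, ENNReal.ofReal (Real.exp (∑ i, (b i * z i + c i * z i ^ 2))) ∂(gam ι)
      = ENNReal.ofReal (∏ i, Real.exp (b i ^ 2 / (2 * (1 - 2 * c i))) / Real.sqrt (1 - 2 * c i)) := by
  rw [ENNReal.ofReal_prod_of_nonneg (fun i _ => by positivity)]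
  simp_rw [← gauss1 _ _ (hc _), Real.exp_sum]
  simp_rw [ENNReal.ofReal_prod_of_nonneg (fun i _ => (Real.exp_pos _).le)]
  exact lint_prod (fun i x => ENNReal.ofReal (Real.exp (b i * x + c i * x ^ 2)))
    (fun i => by fun_prop)

lemma shift1 (m : ℝ) : (gaussianReal 0 1).map (· + m) =
    (gaussianReal 0 1).withDensity (fun x => ENNReal.ofReal (Real.exp (m * x - m ^ 2 / 2))) := by
  rw [gaussianReal_map_add_const, gaussianReal_of_var_ne_zero _ one_ne_zero,
    gaussianReal_of_var_ne_zero _ one_ne_zero,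
    ← withDensity_mul _ (measurable_gaussianPDF _ _) (by fun_prop)]
  congr 1
  ext x
  simp only [Pi.mul_apply, gaussianPDF, gaussianPDFReal]
  rw [← ENNReal.ofReal_mul (by positivity), mul_assoc _ (Real.exp _), ← Real.exp_add]
  simp only [NNReal.coe_one]
  ring_nf

lemma shift_pi {ι : Type} [Fintype ι] (m : ι → ℝ) (F : (ι → ℝ) → ENNReal) (hF : Measurable F) :
    ∫⁻ z, F (fun i => m i + z i) ∂(gam ι) =
    ∫⁻ z, ENNReal.ofReal (Real.exp (∑ i, (m i * z i - m i ^ 2 / 2))) * F z ∂(gam ι) := by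
  have h1 : (gam ι).map (fun z i => z i + m i) = (gam ι).withDensity
      (fun z => ENNReal.ofReal (Real.exp (∑ i, (m i * z i - m i ^ 2 / 2)))) := by
    have := fun i => Measure.isProbabilityMeasure_map (μ := gaussianReal 0 1) (f := (· + m i)) (by fun_prop)
    rw [Measure.pi_map_pi (f := fun i x => x + m i) (fun i => by fun_prop)]
    refine Measure.pi_eq fun s hs => ?_
    rw [withDensity_apply _ (MeasurableSet.univ_pi hs), ← lintegral_indicator (MeasurableSet.univ_pi hs)]
    have e : ∀ z : ι → ℝ, (Set.univ.pi s).indicator (fun z => ENNReal.ofReal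
        (Real.exp (∑ i, (m i * z i - m i ^ 2 / 2)))) z = ∏ i, (s i).indicator
        (fun x => ENNReal.ofReal (Real.exp (m i * x - m i ^ 2 / 2))) (z i) := by
      intro z
      by_cases hz : z ∈ Set.univ.pi s
      · rw [Set.indicator_of_mem hz, Real.exp_sum,
          ENNReal.ofReal_prod_of_nonneg (fun i _ => (Real.exp_pos _).le)]
        refine Finset.prod_congr rfl fun i _ => ?_
        rw [Set.indicator_of_mem (hz i trivial)]
      · rw [Set.indicator_of_notMem hz]
        simp only [Set.mem_pi, Set.mem_univ, true_implies, not_forall] at hz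
        obtain ⟨i, hi⟩ := hz
        exact (Finset.prod_eq_zero (mem_univ i) (Set.indicator_of_notMem hi _)).symm
    simp_rw [e]
    rw [lint_prod _ (fun i => Measurable.indicator (by fun_prop) (hs i))]
    refine Finset.prod_congr rfl fun i _ => ?_
    rw [shift1, withDensity_apply _ (hs i), lintegral_indicator (hs i)]
  have h2 : ∫⁻ z, F (fun i => m i + z i) ∂(gam ι) = ∫⁻ z, F z ∂((gam ι).map (fun z i => z i + m i)) := by
    rw [lintegral_map hF (by fun_prop)]
    simp_rw [add_comm]
  rw [h2, h1, lintegral_withDensity_eq_lintegral_mul _ (by fun_prop) hF]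
  rfl

/-- The likelihood ratio of the spiked samples with respect to the standard Gaussian. -/
def lik {n d : ℕ} (lam : ℝ) (u : Fin d → ℝ) (z : Fin n × Fin d → ℝ) : ℝ :=
  ∏ i, Real.exp (lam / (2 * (1 + lam)) * (∑ j, u j * z (i, j)) ^ 2) / Real.sqrt (1 + lam)

lemma lik_nonneg {n d : ℕ} (lam : ℝ) (u : Fin d → ℝ) (z : Fin n × Fin d → ℝ) :
    0 ≤ lik lam u z := Finset.prod_nonneg fun i _ => by positivity

lemma lik_meas {n d : ℕ} (lam : ℝ) (u : Fin d → ℝ) :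
    Measurable (fun z : Fin n × Fin d → ℝ => lik lam u z) := by
  unfold lik; fun_prop

lemma lik_eq {n d : ℕ} (lam : ℝ) (hl : 0 < lam) (u : Fin d → ℝ) (hu : ∑ j, u j ^ 2 = 1)
    (z : Fin n × Fin d → ℝ) :
    ∫⁻ g, ENNReal.ofReal (Real.exp (∑ q : Fin n × Fin d,
      (Real.sqrt lam * g q.1 * u q.2 * z q - (Real.sqrt lam * g q.1 * u q.2) ^ 2 / 2))) ∂(gam (Fin n))
      = ENNReal.ofReal (lik lam u z) := by
  have e : ∀ g : Fin n → ℝ, (∑ q : Fin n × Fin d,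
      (Real.sqrt lam * g q.1 * u q.2 * z q - (Real.sqrt lam * g q.1 * u q.2) ^ 2 / 2))
      = ∑ i, ((Real.sqrt lam * ∑ j, u j * z (i, j)) * g i + (-lam / 2) * g i ^ 2) := by
    intro g
    rw [Fintype.sum_prod_type]
    refine Finset.sum_congr rfl fun i _ => ?_
    rw [Finset.sum_sub_distrib]
    have : ∑ j, (Real.sqrt lam * g i * u j) ^ 2 / 2 = lam / 2 * g i ^ 2 * ∑ j, u j ^ 2 := by
      rw [Finset.mul_sum]
      refine Finset.sum_congr rfl fun j _ => ?_
      rw [mul_pow, mul_pow, Real.sq_sqrt hl.le]; ring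
    simp only [this, hu]
    rw [Finset.mul_sum, Finset.sum_mul]
    rw [sub_eq_add_neg]
    congr 1
    · refine Finset.sum_congr rfl fun j _ => ?_
      ring
    · ring
  simp_rw [e]
  rw [gpi _ _ (fun i => by linarith)]
  congr 1
  unfold lik
  refine Finset.prod_congr rfl fun i _ => ?_
  have e2 : 1 - 2 * (-lam / 2) = 1 + lam := by ring
  rw [e2, mul_pow, Real.sq_sqrt hl.le]
  congr 2
  ring

lemma mix {n d : ℕ} (lam : ℝ) (hl : 0 < lam) (u : Fin d → ℝ) (hu : ∑ j, u j ^ 2 = 1)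
    (F : (Fin n × Fin d → ℝ) → ENNReal) (hF : Measurable F) :
    ∫⁻ g, ∫⁻ z, F (fun q => Real.sqrt lam * g q.1 * u q.2 + z q) ∂(gam (Fin n × Fin d))
      ∂(gam (Fin n)) = ∫⁻ z, ENNReal.ofReal (lik lam u z) * F z ∂(gam (Fin n × Fin d)) := by
  simp_rw [shift_pi (fun q : Fin n × Fin d => Real.sqrt lam * _ * u q.2) F hF]
  rw [lintegral_lintegral_swap]
  · refine lintegral_congr fun z => ?_
    rw [lintegral_mul_const _ (by fun_prop), lik_eq lam hl u hu]
  · apply Measurable.aemeasurable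
    simp only [Function.uncurry_def]
    apply Measurable.mul
    · fun_prop
    · exact hF.comp measurable_snd

lemma lik_one {n d : ℕ} (lam : ℝ) (hl : 0 < lam) (u : Fin d → ℝ) (hu : ∑ j, u j ^ 2 = 1) :
    ∫⁻ z, ENNReal.ofReal (lik lam u z) ∂(gam (Fin n × Fin d)) = 1 := by
  have := mix (n := n) lam hl u hu (fun _ => 1) measurable_const
  simpa using this.symm

lemma risk_eq {n d : ℕ} (lam : ℝ) (hl : 0 < lam) (u : Fin d → ℝ) (hu : ∑ j, u j ^ 2 = 1)
    (F : (Fin n → Fin d → ℝ) → ENNReal) (hF : Measurable F)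
    (Ω : Type) (_ : MeasurableSpace Ω) (μ : Measure Ω) (_ : IsProbabilityMeasure μ)
    (x : Fin n → Ω → Fin d → ℝ) (hx : IsSpikedWishart μ lam u x) :
    ∫⁻ ω, F (fun i => x i ω) ∂μ =
      ∫⁻ z, ENNReal.ofReal (lik lam u z) * F (fun i j => z (i, j)) ∂(gam (Fin n × Fin d)) := by
  obtain ⟨G, hG, hind, hlaw, hxe⟩ := hx
  have hmap := (iIndepFun_iff_map_fun_eq_pi_map (fun i => (hG i).aemeasurable)).1 hind
  simp_rw [hlaw] at hmap
  have e0 : ∀ ω, (fun i => x i ω) = fun i j =>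
      Real.sqrt lam * G (Sum.inl i) ω * u j + G (Sum.inr (i, j)) ω := by
    intro ω; ext i j; exact hxe i ω j
  have hF' : Measurable (fun w : (Fin n ⊕ Fin n × Fin d) → ℝ => F (fun i j =>
      Real.sqrt lam * w (Sum.inl i) * u j + w (Sum.inr (i, j)))) := hF.comp (by fun_prop)
  have e1 : ∫⁻ ω, F (fun i => x i ω) ∂μ = ∫⁻ w, F (fun i j =>
      Real.sqrt lam * w (Sum.inl i) * u j + w (Sum.inr (i, j))) ∂(gam (Fin n ⊕ Fin n × Fin d)) := by
    rw [gam, ← hmap, lintegral_map hF' (measurable_pi_lambda _ hG)]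
    simp_rw [e0]
  rw [e1, ← (measurePreserving_sumPiEquivProdPi_symm
    (fun _ : Fin n ⊕ Fin n × Fin d => gaussianReal 0 1)).lintegral_comp hF']
  refine (lintegral_prod _ (hF'.comp (MeasurableEquiv.measurable _)).aemeasurable).trans ?_
  exact mix lam hl u hu (fun z => F (fun i j => z (i, j))) (hF.comp (by fun_prop))

lemma affinity {n d : ℕ} (lam : ℝ) (hl : 0 < lam) (p : Fin d → ℝ) (j : Fin d) (b : ℝ)
    (hpj : p j = 0) (hp : ∑ i, p i ^ 2 = 1 - b ^ 2) (hb : b ^ 2 ≤ 1) (u v : Fin d → ℝ)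
    (hu : ∀ i, u i = p i + if i = j then b else 0) (hv : ∀ i, v i = p i - if i = j then b else 0) :
    ∫⁻ z, ENNReal.ofReal (Real.sqrt (lik lam u z * lik lam v z)) ∂(gam (Fin n × Fin d))
      = ENNReal.ofReal ((1 / Real.sqrt (1 + lam ^ 2 * b ^ 2 * (1 - b ^ 2) / (1 + lam))) ^ n) := by
  set κ : ℝ := lam / (2 * (1 + lam)) with hκ
  have hκ0 : 0 < κ := by positivity
  have hκ1 : κ < 1 / 2 := by
    rw [hκ, div_lt_div_iff₀ (by positivity) (by positivity)]; linarith
  have hb0 : 0 ≤ b ^ 2 := sq_nonneg b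
  have hκb : κ * b ^ 2 < 1 / 2 := by nlinarith
  have hκb' : κ * (1 - b ^ 2) < 1 / 2 := by nlinarith
  have hκb0 : 0 < 1 - 2 * (κ * b ^ 2) := by linarith
  have hκb0' : 0 < 1 - 2 * (κ * (1 - b ^ 2)) := by linarith
  have hs1 : 0 < Real.sqrt (1 + lam) := Real.sqrt_pos.2 (by linarith)
  -- pointwise formula
  have e1 : ∀ z : Fin n × Fin d → ℝ, Real.sqrt (lik lam u z * lik lam v z) =
      (1 / Real.sqrt (1 + lam)) ^ n * (Real.exp (∑ i : Fin n, κ * b ^ 2 * z (i, j) ^ 2) *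
        ∏ i : Fin n, Real.exp (κ * (∑ l, p l * z (i, l)) ^ 2)) := by
    intro z
    have hsu : ∀ i, ∑ l, u l * z (i, l) = (∑ l, p l * z (i, l)) + b * z (i, j) := by
      intro i; simp [hu, add_mul, Finset.sum_add_distrib]
    have hsv : ∀ i, ∑ l, v l * z (i, l) = (∑ l, p l * z (i, l)) - b * z (i, j) := by
      intro i; simp [hv, sub_mul, Finset.sum_sub_distrib]
    rw [Real.sqrt_eq_iff_mul_self_eq (mul_nonneg (lik_nonneg _ _ _) (lik_nonneg _ _ _))
      (by positivity)]
    have hc : (1 / Real.sqrt (1 + lam)) ^ n = ∏ _i : Fin n, (1 / Real.sqrt (1 + lam)) := by simp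
    rw [hc, Real.exp_sum]
    unfold lik
    rw [← Finset.prod_mul_distrib, ← Finset.prod_mul_distrib, ← Finset.prod_mul_distrib,
      ← Finset.prod_mul_distrib]
    refine Finset.prod_congr rfl fun i _ => ?_
    rw [hsu, hsv, ← hκ, div_mul_div_comm, ← Real.exp_add, ← Real.exp_add, mul_mul_mul_comm,
      ← Real.exp_add, div_mul_div_comm, mul_one, one_div_mul_eq_div]
    congr 2
    ring
  -- linearization
  have e2 : ∀ z : Fin n × Fin d → ℝ, ENNReal.ofReal (Real.sqrt (lik lam u z * lik lam v z)) =
      ENNReal.ofReal ((1 / Real.sqrt (1 + lam)) ^ n) * ∫⁻ h, ENNReal.ofReal (Real.exp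
        (∑ q : Fin n × Fin d, (Real.sqrt (2 * κ) * h q.1 * p q.2 * z q +
          (if q.2 = j then κ * b ^ 2 else 0) * z q ^ 2))) ∂(gam (Fin n)) := by
    intro z
    rw [e1, ENNReal.ofReal_mul (by positivity), ENNReal.ofReal_mul (by positivity)]
    congr 1
    have h1 : ∀ h : Fin n → ℝ, ∑ q : Fin n × Fin d, (Real.sqrt (2 * κ) * h q.1 * p q.2 * z q +
          (if q.2 = j then κ * b ^ 2 else 0) * z q ^ 2)
        = (∑ i : Fin n, κ * b ^ 2 * z (i, j) ^ 2) +
          ∑ i : Fin n, ((Real.sqrt (2 * κ) * ∑ l, p l * z (i, l)) * h i + 0 * h i ^ 2) := by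
      intro h
      rw [Fintype.sum_prod_type, ← Finset.sum_add_distrib]
      refine Finset.sum_congr rfl fun i _ => ?_
      rw [Finset.sum_add_distrib, add_comm]
      congr 1
      · simp
      · rw [zero_mul, add_zero, Finset.mul_sum, Finset.sum_mul]
        refine Finset.sum_congr rfl fun l _ => ?_
        ring
    simp_rw [h1, Real.exp_add, ENNReal.ofReal_mul (Real.exp_pos _).le]
    rw [lintegral_const_mul _ (by fun_prop)]
    rw [gpi _ _ (fun i => by norm_num)]
    congr 2
    refine Finset.prod_congr rfl fun i _ => ?_
    rw [mul_pow, Real.sq_sqrt (by positivity)]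
    simp only [mul_zero, sub_zero, mul_one, Real.sqrt_one, div_one]
    congr 1
    ring
  simp_rw [e2]
  have hfm : Measurable (Function.uncurry fun (z : Fin n × Fin d → ℝ) (h : Fin n → ℝ) =>
      ENNReal.ofReal (Real.exp
        (∑ q : Fin n × Fin d, (Real.sqrt (2 * κ) * h q.1 * p q.2 * z q +
          (if q.2 = j then κ * b ^ 2 else 0) * z q ^ 2)))) := by
    simp only [Function.uncurry_def]
    fun_prop
  rw [lintegral_const_mul _ hfm.lintegral_prod_right, lintegral_lintegral_swap hfm.aemeasurable]
  have e3 : ∀ h : Fin n → ℝ, ∫⁻ z, ENNReal.ofReal (Real.exp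
        (∑ q : Fin n × Fin d, (Real.sqrt (2 * κ) * h q.1 * p q.2 * z q +
          (if q.2 = j then κ * b ^ 2 else 0) * z q ^ 2))) ∂(gam (Fin n × Fin d))
      = ENNReal.ofReal ((1 / Real.sqrt (1 - 2 * (κ * b ^ 2))) ^ n) *
        ENNReal.ofReal (Real.exp (∑ i, (0 * h i + κ * (1 - b ^ 2) * h i ^ 2))) := by
    intro h
    rw [gpi _ _ (fun q => by split_ifs <;> linarith), ← ENNReal.ofReal_mul (by positivity)]
    congr 1
    have hc : (1 / Real.sqrt (1 - 2 * (κ * b ^ 2))) ^ n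
      = ∏ _i : Fin n, (1 / Real.sqrt (1 - 2 * (κ * b ^ 2))) := by simp
    rw [hc, Real.exp_sum, ← Finset.prod_mul_distrib, Fintype.prod_prod_type]
    refine Finset.prod_congr rfl fun i _ => ?_
    rw [Finset.prod_div_distrib, ← Real.exp_sum, one_div, mul_comm _ (Real.exp _), div_eq_mul_inv]
    congr 1
    · congr 1
      rw [zero_mul, zero_add, ← hp, Finset.mul_sum, Finset.sum_mul]
      refine Finset.sum_congr rfl fun l _ => ?_
      by_cases hlj : l = j
      · subst hlj; simp [hpj]
      · simp only [hlj, if_false, mul_pow, Real.sq_sqrt (by positivity : (0:ℝ) ≤ 2 * κ)]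
        ring
    · congr 1
      rw [Finset.prod_eq_single j]
      · simp
      · intro l _ hlj; simp [hlj]
      · simp
  simp_rw [e3]
  rw [lintegral_const_mul _ (by fun_prop), gpi _ _ (fun i => hκb'),
    ← ENNReal.ofReal_mul (by positivity), ← ENNReal.ofReal_mul (by positivity)]
  congr 1
  simp only [ne_eq, OfNat.ofNat_ne_zero, not_false_eq_true, zero_pow, zero_div, Real.exp_zero,
    Finset.prod_const, Finset.card_univ, Fintype.card_fin]
  rw [← mul_pow, ← mul_pow]
  congr 1
  rw [one_div_mul_one_div, one_div_mul_one_div, ← Real.sqrt_mul hκb0.le, ← Real.sqrt_mul (by linarith)]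
  congr 2
  rw [hκ]
  field_simp
  ring

lemma affinity_ge (n : ℕ) (x : ℝ) (hx : 0 ≤ x) (hn : n * x ≤ 1) :
    1 / 2 ≤ (1 / Real.sqrt (1 + x)) ^ n := by
  have h1 : Real.sqrt (1 + x) ≤ Real.exp (x / 2) := by
    rw [Real.exp_half]
    exact Real.sqrt_le_sqrt (by linarith [Real.add_one_le_exp x])
  have h2 : Real.sqrt (1 + x) ^ n ≤ 2 := by
    calc Real.sqrt (1 + x) ^ n ≤ Real.exp (x / 2) ^ n := by gcongr
      _ = Real.exp (n * x / 2) := by rw [← Real.exp_nat_mul]; congr 1; ring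
      _ ≤ Real.exp (1 / 2) := Real.exp_le_exp.2 (by linarith)
      _ ≤ 2 := by
        rw [Real.exp_half]
        rw [Real.sqrt_le_left (by norm_num)]
        linarith [Real.exp_one_lt_d9]
  have : 0 < Real.sqrt (1 + x) := Real.sqrt_pos.2 (by linarith)
  rw [_root_.one_div_pow]
  exact one_div_le_one_div_of_le (by positivity) h2

lemma min_ge {Z : Type} [MeasurableSpace Z] (ν : Measure Z) (A B : Z → ℝ) (hA : ∀ z, 0 ≤ A z)
    (hB : ∀ z, 0 ≤ B z) (mA : Measurable A) (mB : Measurable B)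
    (iA : ∫⁻ z, ENNReal.ofReal (A z) ∂ν = 1) (iB : ∫⁻ z, ENNReal.ofReal (B z) ∂ν = 1)
    (h : ENNReal.ofReal (1 / 2) ≤ ∫⁻ z, ENNReal.ofReal (Real.sqrt (A z * B z)) ∂ν) :
    ENNReal.ofReal (1 / 8) ≤ ∫⁻ z, ENNReal.ofReal (min (A z) (B z)) ∂ν := by
  have pt : ∀ z, ENNReal.ofReal (Real.sqrt (A z * B z)) ≤
      ENNReal.ofReal 2 * ENNReal.ofReal (min (A z) (B z)) + ENNReal.ofReal (1 / 8) *
        (ENNReal.ofReal (A z) + ENNReal.ofReal (B z)) := by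
    intro z
    have h0 : 0 ≤ min (A z) (B z) := le_min (hA z) (hB z)
    rw [← ENNReal.ofReal_add (hA z) (hB z), ← ENNReal.ofReal_mul (by norm_num),
      ← ENNReal.ofReal_mul (by norm_num), ← ENNReal.ofReal_add (by linarith)
        (by linarith [hA z, hB z])]
    apply ENNReal.ofReal_le_ofReal
    rw [Real.sqrt_le_left (by linarith [hA z, hB z])]
    have := hA z
    have := hB z
    rcases le_total (A z) (B z) with hh | hh
    · rw [min_eq_left hh]; nlinarith [sq_nonneg (2 * A z - B z / 8), mul_nonneg (hA z) (hB z)]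
    · rw [min_eq_right hh]; nlinarith [sq_nonneg (2 * B z - A z / 8), mul_nonneg (hA z) (hB z)]
  have h2 := h.trans (lintegral_mono pt)
  rw [lintegral_add_left (by fun_prop), lintegral_const_mul _ (by fun_prop),
    lintegral_const_mul _ (by fun_prop), lintegral_add_left (by fun_prop), iA, iB] at h2
  set m := ∫⁻ z, ENNReal.ofReal (min (A z) (B z)) ∂ν with hm
  by_cases hmt : m = ⊤
  · rw [hmt]; exact le_top
  · rw [← ENNReal.ofReal_toReal hmt] at h2 ⊢
    apply ENNReal.ofReal_le_ofReal
    have e2 : (1 : ENNReal) + 1 = ENNReal.ofReal 2 := by norm_num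
    rw [e2, ← ENNReal.ofReal_mul (by norm_num), ← ENNReal.ofReal_mul (by norm_num),
      ← ENNReal.ofReal_add (by positivity) (by norm_num),
      ENNReal.ofReal_le_ofReal_iff (by positivity)] at h2
    linarith

/-- Hypercube of hypotheses. -/
def vec {d : ℕ} (k : ℕ) (α b : ℝ) (σ : Fin d → Bool) : Fin d → ℝ := fun i =>
  if (i : ℕ) = 0 then α else if (i : ℕ) < k then (if σ i then b else -b) else 0

/-- The active sign coordinates. -/
def act (d k : ℕ) : Finset (Fin d) := univ.filter fun i => (i : ℕ) ≠ 0 ∧ (i : ℕ) < k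

lemma act_card (d k : ℕ) (hk : k ≤ d) : (act d k).card = k - 1 := by
  have : (act d k).map Fin.valEmbedding = Finset.Ico 1 k := by
    ext x
    simp only [act, Finset.mem_map, Finset.mem_filter, Finset.mem_univ, true_and,
      Fin.valEmbedding_apply, Finset.mem_Ico]
    constructor
    · rintro ⟨i, ⟨h1, h2⟩, rfl⟩; omega
    · rintro ⟨h1, h2⟩
      exact ⟨⟨x, by omega⟩, ⟨by simp; omega, h2⟩, rfl⟩
  rw [← Finset.card_map Fin.valEmbedding, this, Nat.card_Ico]

lemma vec_sq {d k : ℕ} (hk : k ≤ d) (h1 : 1 ≤ k) (α b : ℝ) (σ : Fin d → Bool) :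
    ∑ i, vec k α b σ i ^ 2 = α ^ 2 + ((k - 1 : ℕ) : ℝ) * b ^ 2 := by
  have e : ∀ i : Fin d, vec k α b σ i ^ 2 = (if i = ⟨0, by omega⟩ then α ^ 2 else 0) +
      (if i ∈ act d k then b ^ 2 else 0) := by
    intro i
    simp only [vec, act, Finset.mem_filter, Finset.mem_univ, true_and, Fin.ext_iff]
    by_cases h0 : (i : ℕ) = 0
    · simp [h0]
    · by_cases hik : (i : ℕ) < k
      · simp [h0, hik]
      · simp [h0, hik]
  simp_rw [e]
  rw [Finset.sum_add_distrib, Finset.sum_ite_eq' univ, Finset.sum_ite_mem, Finset.univ_inter,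
    Finset.sum_const, act_card d k hk]
  simp

lemma pair {n d k : ℕ} (hk : k ≤ d) (h1 : 1 ≤ k) (lam : ℝ) (hl : 0 < lam) (α b : ℝ) (hα : 0 ≤ α)
    (hb : 0 ≤ b) (hunit : α ^ 2 + ((k - 1 : ℕ) : ℝ) * b ^ 2 = 1)
    (hnb : n * (lam ^ 2 * b ^ 2 / (1 + lam)) ≤ 1)
    (w : (Fin n × Fin d → ℝ) → ℝ) (hw : Measurable w) (j : Fin d) (hj : j ∈ act d k)
    (σ τ : Fin d → Bool) (hσ : σ j = true) (hτ : τ j = false) (hst : ∀ i, i ≠ j → σ i = τ i) :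
    ENNReal.ofReal (α * b / 4) ≤
    (∫⁻ z, ENNReal.ofReal (lik lam (vec k α b σ) z) * ENNReal.ofReal |w z - α * vec k α b σ j|
      ∂(gam (Fin n × Fin d))) +
    ∫⁻ z, ENNReal.ofReal (lik lam (vec k α b τ) z) * ENNReal.ofReal |w z - α * vec k α b τ j|
      ∂(gam (Fin n × Fin d)) := by
  have hj' : (j : ℕ) ≠ 0 ∧ (j : ℕ) < k := by simpa [act] using hj
  have vσ : vec k α b σ j = b := by simp [vec, hj', hσ]
  have vτ : vec k α b τ j = -b := by simp [vec, hj', hτ]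
  have uσ := (vec_sq hk h1 α b σ).trans hunit
  have uτ := (vec_sq hk h1 α b τ).trans hunit
  have hb1 : b ^ 2 ≤ 1 := by
    have := Finset.single_le_sum (f := fun i => vec k α b σ i ^ 2) (fun i _ => sq_nonneg _)
      (mem_univ j)
    simp only [vσ] at this
    linarith
  set p : Fin d → ℝ := fun i => if i = j then 0 else vec k α b σ i with hp
  have hps : ∑ i, p i ^ 2 = 1 - b ^ 2 := by
    have : ∀ i, p i ^ 2 = vec k α b σ i ^ 2 - if i = j then b ^ 2 else 0 := by
      intro i
      by_cases hi : i = j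
      · subst hi; simp [hp, vσ]
      · simp [hp, hi]
    simp_rw [this]
    rw [Finset.sum_sub_distrib, uσ]
    simp
  have haff := affinity (n := n) lam hl p j b (by simp [hp]) hps hb1 (vec k α b σ) (vec k α b τ)
    (by
      intro i
      by_cases hi : i = j
      · subst hi; simp [hp, vσ]
      · simp [hp, hi])
    (by
      intro i
      by_cases hi : i = j
      · subst hi; simp [hp, vτ]
      · simp [hp, hi, vec, hst i hi])
  have hx0 : 0 ≤ lam ^ 2 * b ^ 2 * (1 - b ^ 2) / (1 + lam) :=
    div_nonneg (mul_nonneg (by positivity) (by linarith)) (by linarith)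
  have hx1 : (n : ℝ) * (lam ^ 2 * b ^ 2 * (1 - b ^ 2) / (1 + lam)) ≤ 1 := by
    refine le_trans ?_ hnb
    have h3 : lam ^ 2 * b ^ 2 * (1 - b ^ 2) ≤ lam ^ 2 * b ^ 2 :=
      mul_le_of_le_one_right (by positivity) (by linarith [sq_nonneg b])
    gcongr
  have hm := min_ge (gam (Fin n × Fin d)) (lik lam (vec k α b σ)) (lik lam (vec k α b τ))
    (lik_nonneg _ _) (lik_nonneg _ _) (lik_meas _ _) (lik_meas _ _) (lik_one lam hl _ uσ)
    (lik_one lam hl _ uτ)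
    (by rw [haff]; exact ENNReal.ofReal_le_ofReal (affinity_ge n _ hx0 hx1))
  have mσ := lik_meas (n := n) lam (vec k α b σ)
  have mτ := lik_meas (n := n) lam (vec k α b τ)
  rw [← lintegral_add_left (by fun_prop)]
  calc ENNReal.ofReal (α * b / 4) = ENNReal.ofReal (2 * (α * b)) * ENNReal.ofReal (1 / 8) := by
        rw [← ENNReal.ofReal_mul (by positivity)]; congr 1; ring
    _ ≤ ENNReal.ofReal (2 * (α * b)) * ∫⁻ z, ENNReal.ofReal (min (lik lam (vec k α b σ) z)
        (lik lam (vec k α b τ) z)) ∂(gam (Fin n × Fin d)) := by gcongr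
    _ ≤ _ := by
        rw [← lintegral_const_mul _ (by fun_prop)]
        refine lintegral_mono fun z => ?_
        have l1 := lik_nonneg lam (vec k α b σ) z
        have l2 := lik_nonneg lam (vec k α b τ) z
        simp only
        rw [← ENNReal.ofReal_mul (by positivity), ← ENNReal.ofReal_mul l1, ← ENNReal.ofReal_mul l2,
          ← ENNReal.ofReal_add (by positivity) (by positivity), vσ, vτ]
        apply ENNReal.ofReal_le_ofReal
        set m := min (lik lam (vec k α b σ) z) (lik lam (vec k α b τ) z)
        have m0 : 0 ≤ m := le_min l1 l2
        have t : 2 * (α * b) ≤ |w z - α * b| + |w z - α * -b| := by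
          have a1 := neg_abs_le (w z - α * b)
          have a2 := le_abs_self (w z - α * -b)
          linarith
        calc 2 * (α * b) * m ≤ (|w z - α * b| + |w z - α * -b|) * m := by gcongr
          _ = m * |w z - α * b| + m * |w z - α * -b| := by ring
          _ ≤ _ := by
            gcongr
            · exact min_le_left _ _
            · exact min_le_right _ _

lemma sum_pair {n d k : ℕ} (hk : k ≤ d) (h1 : 1 ≤ k) (lam : ℝ) (hl : 0 < lam) (α b : ℝ) (hα : 0 ≤ α)
    (hb : 0 ≤ b) (hunit : α ^ 2 + ((k - 1 : ℕ) : ℝ) * b ^ 2 = 1)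
    (hnb : n * (lam ^ 2 * b ^ 2 / (1 + lam)) ≤ 1)
    (w : (Fin n × Fin d → ℝ) → ℝ) (hw : Measurable w) (j : Fin d) (hj : j ∈ act d k) :
    ∑ _σ : Fin d → Bool, ENNReal.ofReal (α * b / 8) ≤
    ∑ σ : Fin d → Bool,
      ∫⁻ z, ENNReal.ofReal (lik lam (vec k α b σ) z) * ENNReal.ofReal |w z - α * vec k α b σ j|
      ∂(gam (Fin n × Fin d)) := by
  set T : (Fin d → Bool) → ENNReal := fun σ =>
    ∫⁻ z, ENNReal.ofReal (lik lam (vec k α b σ) z) * ENNReal.ofReal |w z - α * vec k α b σ j|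
      ∂(gam (Fin n × Fin d)) with hT
  let flip : (Fin d → Bool) → (Fin d → Bool) := fun σ => Function.update σ j (!σ j)
  have hinv : Function.Involutive flip := by
    intro σ
    simp [flip]
  have hsum : ∑ σ, T (flip σ) = ∑ σ, T σ := Equiv.sum_comp hinv.toPerm T
  have hpt : ∀ σ, ENNReal.ofReal (α * b / 4) ≤ T σ + T (flip σ) := by
    intro σ
    cases hσ : σ j with
    | true =>
      exact pair hk h1 lam hl α b hα hb hunit hnb w hw j hj σ (flip σ) hσ (by simp [flip, hσ])
        (fun i hi => by simp [flip, hi])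
    | false =>
      rw [add_comm]
      exact pair hk h1 lam hl α b hα hb hunit hnb w hw j hj (flip σ) σ (by simp [flip, hσ]) hσ
        (fun i hi => by simp [flip, hi])
  have h2 : ∑ _σ : Fin d → Bool, ENNReal.ofReal (α * b / 4) ≤ 2 * ∑ σ, T σ := by
    refine (Finset.sum_le_sum fun σ _ => hpt σ).trans ?_
    rw [Finset.sum_add_distrib, hsum, two_mul]
  have e : ENNReal.ofReal (α * b / 4) = 2 * ENNReal.ofReal (α * b / 8) := by
    rw [show (2 : ENNReal) = ENNReal.ofReal 2 by norm_num, ← ENNReal.ofReal_mul (by norm_num)]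
    congr 1; ring
  rw [e, ← Finset.mul_sum] at h2
  exact (ENNReal.mul_le_mul_iff_right (by norm_num) (by norm_num)).1 h2

lemma frob_ge {d : ℕ} (M : Matrix (Fin d) (Fin d) ℝ) (i : Fin d) (J : Finset (Fin d))
    (hJ : 0 < J.card) :
    1 / Real.sqrt J.card * ∑ j ∈ J, |M i j| ≤ frob M := by
  have h1 : (∑ j ∈ J, |M i j|) ^ 2 ≤ J.card * ∑ j ∈ J, |M i j| ^ 2 := sq_sum_le_card_mul_sum_sq
  have h2 : ∑ j ∈ J, |M i j| ^ 2 ≤ ∑ i, ∑ j, M i j ^ 2 := by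
    simp_rw [sq_abs]
    refine (Finset.sum_le_univ_sum_of_nonneg fun j => sq_nonneg _).trans ?_
    exact Finset.single_le_sum (f := fun i => ∑ j, M i j ^ 2)
      (fun i _ => Finset.sum_nonneg fun j _ => sq_nonneg _) (mem_univ i)
  have hc : (0 : ℝ) < J.card := by exact_mod_cast hJ
  rw [one_div_mul_eq_div, div_le_iff₀ (by positivity), frob, mul_comm, ← Real.sqrt_mul hc.le]
  apply Real.le_sqrt_of_sq_le
  exact h1.trans (by gcongr)

lemma num_bound (k n : ℕ) (hk : 3 ≤ k) (hn : 1 ≤ n) (lam : ℝ) (hl : 0 < lam) (b : ℝ) (hb : 0 ≤ b)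
    (hb2 : b ^ 2 = min ((1 + lam) / (n * lam ^ 2)) (1 / (2 * ((k - 1 : ℕ) : ℝ)))) :
    min (1 / (4 * Real.sqrt (Real.log k)))
      (1 / 4 * Real.sqrt ((1 + lam) / (8 * lam ^ 2)) * Real.sqrt ((k / Real.log k) / n))
      ≤ Real.sqrt ((k - 1 : ℕ) : ℝ) * b := by
  have hm : ((k - 1 : ℕ) : ℝ) = k - 1 := by rw [Nat.cast_sub (by omega)]; simp
  have hk' : (3 : ℝ) ≤ k := by exact_mod_cast hk
  have hn' : (1 : ℝ) ≤ n := by exact_mod_cast hn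
  have hlog : 1 ≤ Real.log k := by
    rw [Real.le_log_iff_exp_le (by linarith)]
    linarith [Real.exp_one_lt_d9]
  have hmb : Real.sqrt ((k - 1 : ℕ) : ℝ) * b = Real.sqrt (((k - 1 : ℕ) : ℝ) * b ^ 2) := by
    rw [Real.sqrt_mul (by positivity), Real.sqrt_sq hb]
  rw [hmb, hm, hb2, hm]
  rcases min_choice ((1 + lam) / (n * lam ^ 2)) (1 / (2 * ((k : ℝ) - 1))) with h | h
  · rw [h]
    refine (min_le_right _ _).trans ?_
    have h1 : Real.sqrt ((1 + lam) / (8 * lam ^ 2)) * Real.sqrt ((k / Real.log k) / n) ≤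
        Real.sqrt (((k : ℝ) - 1) * ((1 + lam) / (n * lam ^ 2))) := by
      rw [← Real.sqrt_mul (by positivity)]
      apply Real.sqrt_le_sqrt
      have h2 : (k : ℝ) / Real.log k ≤ 2 * (k - 1) := by
        rw [div_le_iff₀ (by linarith)]; nlinarith
      have h3 : 0 ≤ (k : ℝ) - 1 := by linarith
      calc (1 + lam) / (8 * lam ^ 2) * (k / Real.log k / n)
          ≤ (1 + lam) / (8 * lam ^ 2) * (2 * (k - 1) / n) := by gcongr
        _ = (1 / 4) * (((k : ℝ) - 1) * ((1 + lam) / (n * lam ^ 2))) := by field_simp; ring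
        _ ≤ 1 * (((k : ℝ) - 1) * ((1 + lam) / (n * lam ^ 2))) := by gcongr; norm_num
        _ = _ := one_mul _
    have h0 := Real.sqrt_nonneg (((k : ℝ) - 1) * ((1 + lam) / (n * lam ^ 2)))
    linarith
  · rw [h]
    refine (min_le_left _ _).trans ?_
    have h4 : ((k : ℝ) - 1) * (1 / (2 * ((k : ℝ) - 1))) = 1 / 2 := by
      have : (k : ℝ) - 1 ≠ 0 := by linarith
      field_simp
    rw [h4]
    have h5 : 1 ≤ Real.sqrt (Real.log k) := Real.one_le_sqrt.2 hlog
    calc 1 / (4 * Real.sqrt (Real.log k)) ≤ 1 / (4 * 1) := by gcongr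
      _ ≤ Real.sqrt (1 / 2) := by apply Real.le_sqrt_of_sq_le; norm_num

lemma vec_tree {d k : ℕ} (hk : k ≤ d) (h1 : 1 ≤ k) (α b : ℝ) (σ : Fin d → Bool) :
    TreeSparse d k (vec k α b σ) := by
  refine ⟨Finset.Icc 1 k, ⟨by simp, by simp [h1], ?_, ?_⟩, ?_⟩
  · intro i hi; simp at hi; omega
  · intro i hi h2; simp at hi ⊢; omega
  · intro i hi
    simp only [Finset.mem_Icc]
    by_contra hc
    apply hi
    have : ¬ ((i : ℕ) < k) := by omega
    simp [vec, this]
    omega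

/-- Corollary 5(b): minimax lower bound for tree-sparse PCA. -/
theorem minimax_lower_bound_tree_sparse :
    ∃ c : ℝ, 0 < c ∧ ∃ k0 : ℕ,
      ∀ (h d k n : ℕ), d = 2 ^ h - 1 → k ^ 2 ≤ d → k0 ≤ k → 1 ≤ n →
        ∀ lam : ℝ, 0 < lam →
        ∀ vhat : (Fin n → Fin d → ℝ) → Fin d → ℝ, Measurable vhat →
        ∃ vstar : Fin d → ℝ, TreeSparse d k vstar ∧ nrm vstar = 1 ∧
          ∀ (Ω : Type) (_ : MeasurableSpace Ω) (μ : Measure Ω), IsProbabilityMeasure μ →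
            ∀ x : Fin n → Ω → Fin d → ℝ, IsSpikedWishart μ lam vstar x →
              ENNReal.ofReal (c *
                min (1 / (4 * Real.sqrt (Real.log k)))
                  (1 / 4 * Real.sqrt ((1 + lam) / (8 * lam ^ 2)) *
                    Real.sqrt ((k / Real.log k) / n)))
              ≤ ∫⁻ ω, ENNReal.ofReal
                  (frob (vecMulVec (vhat fun i => x i ω) (vhat fun i => x i ω) -
                    vecMulVec vstar vstar)) ∂μ := by
  refine ⟨1 / 100, by norm_num, 3, ?_⟩
  intro h d k n _ hkd hk hn lam hl vhat hvhat
  have hkd' : k ≤ d := by nlinarith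
  have h1 : 1 ≤ k := by omega
  have hmpos : 0 < k - 1 := by omega
  have hmR : (0 : ℝ) < ((k - 1 : ℕ) : ℝ) := by exact_mod_cast hmpos
  have hnR : (0 : ℝ) < n := by exact_mod_cast hn
  set b2 : ℝ := min ((1 + lam) / (n * lam ^ 2)) (1 / (2 * ((k - 1 : ℕ) : ℝ))) with hb2
  have hb20 : 0 ≤ b2 := le_min (by positivity) (by positivity)
  set b : ℝ := Real.sqrt b2 with hb
  have hbsq : b ^ 2 = b2 := Real.sq_sqrt hb20
  have hb0 : 0 ≤ b := Real.sqrt_nonneg _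
  have hmb : ((k - 1 : ℕ) : ℝ) * b ^ 2 ≤ 1 / 2 := by
    rw [hbsq]
    calc ((k - 1 : ℕ) : ℝ) * b2 ≤ ((k - 1 : ℕ) : ℝ) * (1 / (2 * ((k - 1 : ℕ) : ℝ))) := by
          gcongr; exact min_le_right _ _
      _ = 1 / 2 := by field_simp
  set α : ℝ := Real.sqrt (1 - ((k - 1 : ℕ) : ℝ) * b ^ 2) with hα
  have hα0 : 0 ≤ α := Real.sqrt_nonneg _
  have hαsq : α ^ 2 = 1 - ((k - 1 : ℕ) : ℝ) * b ^ 2 := Real.sq_sqrt (by linarith)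
  have hα2 : 1 / 2 ≤ α := by
    apply Real.le_sqrt_of_sq_le; linarith
  have hunit : α ^ 2 + ((k - 1 : ℕ) : ℝ) * b ^ 2 = 1 := by linarith
  have hnb : n * (lam ^ 2 * b ^ 2 / (1 + lam)) ≤ 1 := by
    rw [hbsq]
    calc n * (lam ^ 2 * b2 / (1 + lam))
        ≤ n * (lam ^ 2 * ((1 + lam) / (n * lam ^ 2)) / (1 + lam)) := by
          gcongr; exact min_le_left _ _
      _ = 1 := by field_simp
  have hnum := num_bound k n hk hn lam hl b hb0 hbsq
  set tgt : ℝ := min (1 / (4 * Real.sqrt (Real.log k)))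
      (1 / 4 * Real.sqrt ((1 + lam) / (8 * lam ^ 2)) * Real.sqrt ((k / Real.log k) / n)) with htgt
  set o : Fin d := ⟨0, by omega⟩ with ho
  set F : (Fin d → Bool) → (Fin n → Fin d → ℝ) → ENNReal := fun σ X =>
    ENNReal.ofReal (frob (vecMulVec (vhat X) (vhat X) -
      vecMulVec (vec k α b σ) (vec k α b σ))) with hFdef
  have hFm : ∀ σ, Measurable (F σ) := by
    intro σ
    simp only [hFdef, frob, Matrix.sub_apply, vecMulVec_apply]
    fun_prop
  set C : ENNReal := ENNReal.ofReal (1 / Real.sqrt ((k - 1 : ℕ) : ℝ)) with hC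
  let w : Fin d → (Fin n × Fin d → ℝ) → ℝ := fun j z =>
    vhat (fun i l => z (i, l)) o * vhat (fun i l => z (i, l)) j
  have hcur : Measurable (fun (z : Fin n × Fin d → ℝ) => vhat (fun i l => z (i, l))) :=
    hvhat.comp (by fun_prop)
  have hw : ∀ j, Measurable (w j) := by
    intro j
    exact ((measurable_pi_apply o).comp hcur).mul ((measurable_pi_apply j).comp hcur)
  have hFge : ∀ σ (z : Fin n × Fin d → ℝ), C * ∑ j ∈ act d k,
      ENNReal.ofReal |w j z - α * vec k α b σ j| ≤ F σ (fun i l => z (i, l)) := by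
    intro σ z
    rw [hC, ← ENNReal.ofReal_sum_of_nonneg (fun _ _ => abs_nonneg _),
      ← ENNReal.ofReal_mul (by positivity)]
    apply ENNReal.ofReal_le_ofReal
    have := frob_ge (vecMulVec (vhat fun i l => z (i, l)) (vhat fun i l => z (i, l)) -
      vecMulVec (vec k α b σ) (vec k α b σ)) o (act d k) (by rw [act_card d k hkd']; exact hmpos)
    rw [act_card d k hkd'] at this
    refine le_trans (le_of_eq ?_) this
    congr 1
  have hrisk : ∀ σ : Fin d → Bool, C * ∑ j ∈ act d k,
      ∫⁻ z, ENNReal.ofReal (lik lam (vec k α b σ) z) * ENNReal.ofReal |w j z - α * vec k α b σ j|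
      ∂(gam (Fin n × Fin d)) ≤ ∫⁻ z, ENNReal.ofReal (lik lam (vec k α b σ) z) *
        F σ (fun i l => z (i, l)) ∂(gam (Fin n × Fin d)) := by
    intro σ
    have mσ := lik_meas (n := n) lam (vec k α b σ)
    have mm : ∀ j, Measurable (fun z : Fin n × Fin d → ℝ => ENNReal.ofReal (lik lam (vec k α b σ) z) *
        ENNReal.ofReal |w j z - α * vec k α b σ j|) := by
      intro j
      have := hw j
      fun_prop
    rw [← lintegral_finsetSum _ (fun j _ => mm j),
      ← lintegral_const_mul _ (Finset.measurable_sum _ fun j _ => mm j)]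
    refine lintegral_mono fun z => ?_
    simp only
    rw [← Finset.mul_sum, mul_left_comm]
    gcongr
    exact hFge σ z
  have hsum : ∑ _σ : Fin d → Bool, ENNReal.ofReal (1 / 100 * tgt) ≤
      ∑ σ : Fin d → Bool, ∫⁻ z, ENNReal.ofReal (lik lam (vec k α b σ) z) *
        F σ (fun i l => z (i, l)) ∂(gam (Fin n × Fin d)) := by
    refine le_trans ?_ (Finset.sum_le_sum fun σ _ => hrisk σ)
    rw [← Finset.mul_sum, Finset.sum_comm]
    have hj : ∀ j ∈ act d k, _ := fun j hj =>
      sum_pair hkd' h1 lam hl α b hα0 hb0 hunit hnb (w j) (hw j) j hj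
    refine le_trans ?_ (mul_le_mul_right (Finset.sum_le_sum hj) C)
    rw [Finset.sum_comm, Finset.mul_sum]
    refine Finset.sum_le_sum fun σ _ => ?_
    rw [Finset.sum_const, act_card d k hkd', nsmul_eq_mul, hC, ← ENNReal.ofReal_natCast,
      ← ENNReal.ofReal_mul (by positivity), ← ENNReal.ofReal_mul (by positivity)]
    apply ENNReal.ofReal_le_ofReal
    have e : 1 / Real.sqrt ((k - 1 : ℕ) : ℝ) * (((k - 1 : ℕ) : ℝ) * (α * b / 8))
        = α / 8 * (Real.sqrt ((k - 1 : ℕ) : ℝ) * b) := by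
      have hs : Real.sqrt ((k - 1 : ℕ) : ℝ) ≠ 0 := by positivity
      have hss := Real.mul_self_sqrt hmR.le
      rw [one_div_mul_eq_div, div_eq_iff hs]
      linear_combination -(α * b / 8) * hss
    rw [e]
    have hpos : 0 ≤ Real.sqrt ((k - 1 : ℕ) : ℝ) * b := by positivity
    nlinarith
  obtain ⟨σ, _, hσ⟩ := ENNReal.exists_le_of_sum_le Finset.univ_nonempty hsum
  have uσ := (vec_sq hkd' h1 α b σ).trans hunit
  refine ⟨vec k α b σ, vec_tree hkd' h1 α b σ, by rw [nrm, uσ, Real.sqrt_one], ?_⟩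
  intro Ω mΩ μ hμ x hx
  have := risk_eq lam hl _ uσ (F σ) (hFm σ) Ω mΩ μ hμ x hx
  rw [← this] at hσ
  exact hσ

end StructuredPCA
end
end

section
/- There exist universal positive constants (c, C₁, C₂, C₃) such that the following holds. Let v* ∈ S^{d−1} be k-tree-sparse, let λ ≥ C₁ and n ≥ C₂ k, let x_1, …, x_n be spiked Wishart samples with spike v* and sample covariance Σ̂, and consider the projected power iterates over 𝓜_T starting from v_0 ∈ 𝓜_T ∩ S^{d−1} with ⟨v_0, v*⟩ ≥ 1/2. Then with probability at least 1 − exp(−ck), simultaneously for all t ≥ 1, ‖v_t − v*‖₂ ≤ 2^{−t} · ‖v_0 − v*‖₂ + C₃ · √( k / n ). -/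
open MeasureTheory ProbabilityTheory Matrix Finset

noncomputable section

namespace StructuredPCA

lemma one_sub_ge_exp {x : ℝ} (hx : |x| ≤ 1 / 4) : Real.exp (-x - x ^ 2) ≤ 1 - x := by
  obtain ⟨h1, h2⟩ := abs_le.mp hx
  have hpos : (0:ℝ) < 1 - x := by linarith
  rw [← Real.le_log_iff_exp_le hpos]
  have h := Real.abs_log_sub_add_sum_range_le (x := x) (by linarith) 2
  simp only [Finset.sum_range_succ, Finset.sum_range_zero] at h
  have h' := (abs_le.mp h).1
  have h3 : |x| ^ (2 + 1) / (1 - |x|) ≤ 4 / 3 * |x| ^ 3 := by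
    rw [div_le_iff₀ (by linarith)]
    nlinarith [pow_nonneg (abs_nonneg x) 3]
  have h4 : |x| ^ 3 ≤ x ^ 2 * (1/4) := by
    rw [← sq_abs x]; nlinarith [sq_nonneg (|x|)]
  norm_num at h'
  nlinarith [sq_nonneg x]

lemma gauss_sq_mgf {t : ℝ} (ht : |t| ≤ 1 / 8) :
    Integrable (fun x : ℝ => Real.exp (t * (x ^ 2 - 1))) (gaussianReal 0 1) ∧
    ∫ x, Real.exp (t * (x ^ 2 - 1)) ∂(gaussianReal 0 1) ≤ Real.exp (2 * t ^ 2) := by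
  obtain ⟨h1, h2⟩ := abs_le.mp ht
  have hb : (0:ℝ) < 1 / 2 - t := by linarith
  have key : ∀ x : ℝ, gaussianPDFReal 0 1 x • Real.exp (t * (x ^ 2 - 1)) =
      ((Real.sqrt (2 * Real.pi))⁻¹ * Real.exp (-t)) * Real.exp (-(1 / 2 - t) * x ^ 2) := by
    intro x
    simp only [gaussianPDFReal, smul_eq_mul, NNReal.coe_one, mul_one, sub_zero]
    rw [mul_assoc, mul_assoc, ← Real.exp_add, ← Real.exp_add]
    congr 2
    ring
  constructor
  · rw [gaussianReal_of_var_ne_zero _ one_ne_zero,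
      integrable_withDensity_iff_integrable_smul' (measurable_gaussianPDF _ _)
        (ae_of_all _ fun _ ↦ gaussianPDF_lt_top)]
    simp only [toReal_gaussianPDF, key]
    exact (integrable_exp_neg_mul_sq hb).const_mul _
  · rw [integral_gaussianReal_eq_integral_smul one_ne_zero]
    simp only [key]
    rw [integral_const_mul, integral_gaussian]
    have hpi := Real.pi_pos
    have e1 : (Real.sqrt (2 * Real.pi))⁻¹ * Real.sqrt (Real.pi / (1 / 2 - t)) =
        Real.sqrt ((1 - 2 * t)⁻¹) := by
      rw [← Real.sqrt_inv, ← Real.sqrt_mul (by positivity)]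
      congr 1
      have : (1 - 2 * t) ≠ 0 := by linarith
      have : (1 / 2 - t) ≠ 0 := by linarith
      field_simp
    rw [mul_right_comm, e1]
    have e2 : Real.exp (t + 2 * t ^ 2) = Real.sqrt (Real.exp (2 * t + (2 * t) ^ 2)) := by
      rw [eq_comm, Real.sqrt_eq_iff_mul_self_eq (by positivity) (by positivity), ← Real.exp_add]
      congr 1; ring
    have e3 : Real.sqrt ((1 - 2 * t)⁻¹) ≤ Real.exp (t + 2 * t ^ 2) := by
      rw [e2]
      apply Real.sqrt_le_sqrt
      have := one_sub_ge_exp (x := 2 * t) (by rw [abs_mul]; norm_num; linarith)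
      rw [inv_le_comm₀ (by linarith) (by positivity), ← Real.exp_neg]
      have e4 : -(2 * t + (2 * t) ^ 2) = -(2 * t) - (2 * t) ^ 2 := by ring
      rw [e4]
      exact this
    calc _ ≤ Real.exp (t + 2 * t ^ 2) * Real.exp (-t) := by gcongr
      _ = _ := by rw [← Real.exp_add]; congr 1; ring

/-- chi-square two-sided tail bound -/
lemma chi_tail {Ω : Type*} [MeasurableSpace Ω] {μ : Measure Ω} [IsProbabilityMeasure μ] {n : ℕ}
    (Y : Fin n → Ω → ℝ) (hm : ∀ i, Measurable (Y i)) (hi : iIndepFun Y μ)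
    (hY : ∀ i, μ.map (Y i) = gaussianReal 0 1) {s : ℝ} (hs : 0 ≤ s) (hs1 : s ≤ 1 / 2) :
    μ.real {ω | n * s < |∑ i, (Y i ω ^ 2 - 1)|} ≤ 2 * Real.exp (-(n * s ^ 2 / 8)) := by
  set X : Fin n → Ω → ℝ := fun i ω => Y i ω ^ 2 - 1 with hX
  have hXm : ∀ i, Measurable (X i) := fun i => ((hm i).pow_const 2).sub_const 1
  have hXi : iIndepFun X μ := hi.comp (fun _ y => y ^ 2 - 1) (fun _ => by fun_prop)
  have hint : ∀ t : ℝ, |t| ≤ 1 / 8 → ∀ i, Integrable (fun ω => Real.exp (t * X i ω)) μ := by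
    intro t ht i
    have := (gauss_sq_mgf ht).1
    rw [← hY i] at this
    exact this.comp_measurable (hm i)
  have hmgf : ∀ t : ℝ, |t| ≤ 1 / 8 → mgf (∑ i, X i) μ t ≤ Real.exp (n * (2 * t ^ 2)) := by
    intro t ht
    rw [hXi.mgf_sum hXm, Real.exp_nat_mul]
    calc _ ≤ ∏ i : Fin n, Real.exp (2 * t ^ 2) := by
          apply Finset.prod_le_prod (fun i _ => mgf_nonneg)
          intro i _
          have := (gauss_sq_mgf ht).2
          rw [← hY i, integral_map (hm i).aemeasurable
            (by apply Measurable.aestronglyMeasurable; fun_prop)] at this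
          exact this
      _ = _ := by simp
  have hsum : ∀ t : ℝ, |t| ≤ 1 / 8 → Integrable (fun ω => Real.exp (t * (∑ i, X i) ω)) μ :=
    fun t ht => hXi.integrable_exp_mul_sum hXm (fun i _ => hint t ht i)
  have ht1 : |s / 4| ≤ 1 / 8 := by rw [abs_of_nonneg (by positivity)]; linarith
  have ht2 : |-(s / 4)| ≤ 1 / 8 := by rw [abs_neg]; exact ht1
  have hup := measure_ge_le_exp_mul_mgf (μ := μ) (X := ∑ i, X i) (t := s / 4) (n * s)
    (by positivity) (hsum _ ht1)
  have hlo := measure_le_le_exp_mul_mgf (μ := μ) (X := ∑ i, X i) (t := -(s / 4)) (-(n * s))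
    (by linarith) (hsum _ ht2)
  have hsub : {ω | n * s < |∑ i, (Y i ω ^ 2 - 1)|} ⊆
      {ω | n * s ≤ (∑ i, X i) ω} ∪ {ω | (∑ i, X i) ω ≤ -(n * s)} := by
    intro ω hω
    simp only [Set.mem_ofPred_eq, Set.mem_union, Finset.sum_apply, hX] at hω ⊢
    rcases lt_abs.mp hω with h | h
    · left; exact h.le
    · right; linarith
  have b1 : Real.exp (-(s / 4) * (n * s)) * mgf (∑ i, X i) μ (s / 4) ≤
      Real.exp (-(n * s ^ 2 / 8)) := by
    calc _ ≤ Real.exp (-(s / 4) * (n * s)) * Real.exp (n * (2 * (s / 4) ^ 2)) := by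
          gcongr; exact hmgf _ ht1
      _ = _ := by rw [← Real.exp_add]; congr 1; ring
  have b2 : Real.exp (-(-(s / 4)) * (-(n * s))) * mgf (∑ i, X i) μ (-(s / 4)) ≤
      Real.exp (-(n * s ^ 2 / 8)) := by
    calc _ ≤ Real.exp (-(-(s / 4)) * (-(n * s))) * Real.exp (n * (2 * (-(s / 4)) ^ 2)) := by
          gcongr; exact hmgf _ ht2
      _ = _ := by rw [← Real.exp_add]; congr 1; ring
  calc _ ≤ μ.real ({ω | n * s ≤ (∑ i, X i) ω} ∪ {ω | (∑ i, X i) ω ≤ -(n * s)}) :=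
        measureReal_mono hsub
    _ ≤ _ := measureReal_union_le _ _
    _ ≤ _ := by linarith

lemma gauss_lin {Ω : Type*} [MeasurableSpace Ω] {μ : Measure Ω} [IsProbabilityMeasure μ]
    {P : Type*} [Fintype P] {n : ℕ} (G : P → Ω → ℝ) (hm : ∀ p, Measurable (G p))
    (hi : iIndepFun G μ) (hG : ∀ p, μ.map (G p) = gaussianReal 0 1)
    (c : Fin n → P → ℝ) (hc : ∀ i j, ∑ p, c i p * c j p = if i = j then 1 else 0) :
    iIndepFun (fun i ω => ∑ p, c i p * G p ω) μ ∧
    ∀ i, μ.map (fun ω => ∑ p, c i p * G p ω) = gaussianReal 0 1 := by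
  classical
  have hgl : ∀ p, HasGaussianLaw (G p) μ := fun p => ⟨by rw [hG p]; infer_instance⟩
  have hLp : ∀ p, MemLp (G p) 2 μ := fun p => (hgl p).memLp_two
  have hcov : ∀ p q, cov[G p, G q; μ] = if p = q then 1 else 0 := by
    intro p q
    split_ifs with h
    · subst h
      rw [covariance_self (hm p).aemeasurable,
        show G p = id ∘ G p from rfl, ← variance_map aemeasurable_id (hm p).aemeasurable, hG p]
      simp
    · exact (hi.indepFun h).covariance_eq_zero (hLp p) (hLp q)
  have hmean : ∀ p, ∫ ω, G p ω ∂μ = 0 := by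
    intro p
    have := integral_map (μ := μ) (φ := G p) (f := fun x => x) (hm p).aemeasurable
      (by apply Measurable.aestronglyMeasurable; fun_prop)
    rw [← this, hG p]; simp
  have hLpc : ∀ i p, MemLp (fun ω => c i p * G p ω) 2 μ := fun i p => (hLp p).const_mul _
  have hcovY : ∀ i j, cov[fun ω => ∑ p, c i p * G p ω, fun ω => ∑ p, c j p * G p ω; μ] =
      if i = j then 1 else 0 := by
    intro i j
    rw [covariance_fun_sum_fun_sum (hLpc i) (hLpc j)]
    simp only [covariance_const_mul_left, covariance_const_mul_right, hcov]
    simp [hc, mul_comm]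
  have hjoint := iIndepFun.hasGaussianLaw hgl hi
  have hY : HasGaussianLaw (fun ω => fun i => ∑ p, c i p * G p ω) μ := by
    let L : (P → ℝ) →L[ℝ] (Fin n → ℝ) :=
      LinearMap.toContinuousLinearMap (Matrix.mulVecLin (Matrix.of c))
    have := hjoint.map_fun L
    exact this
  refine ⟨hY.iIndepFun_of_covariance_eq_zero fun i j hij => by rw [hcovY, if_neg hij], fun i => ?_⟩
  have h1 : HasGaussianLaw (fun ω => ∑ p, c i p * G p ω) μ := hY.map_fun (ContinuousLinearMap.proj i)
  rw [h1.map_eq_gaussianReal, ← covariance_self h1.aemeasurable, hcovY,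
    integral_finsetSum _ (fun p _ => (hLpc i p).integrable (by norm_num))]
  simp [integral_const_mul, hmean]

lemma code_inj {T T' : Finset ℕ} (h1 : 1 ∈ T) (h1' : 1 ∈ T')
    (h0 : ∀ i ∈ T, 1 ≤ i) (h0' : ∀ i ∈ T', 1 ≤ i)
    (hp : ∀ i ∈ T, 2 ≤ i → i / 2 ∈ T) (hp' : ∀ i ∈ T', 2 ≤ i → i / 2 ∈ T')
    (hsub : ∀ c, (∃ m ∈ T, 2 ≤ m ∧ c = 2 * #{q ∈ T | q < m / 2} + m % 2) ↔
      (∃ m ∈ T', 2 ≤ m ∧ c = 2 * #{q ∈ T' | q < m / 2} + m % 2)) : T = T' := by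
  have rank_inj : ∀ (U : Finset ℕ) (p q : ℕ), p ∈ U → q ∈ U →
      #{r ∈ U | r < p} = #{r ∈ U | r < q} → p = q := by
    have aux : ∀ (U : Finset ℕ) (p q : ℕ), p ∈ U → p < q →
        #{r ∈ U | r < p} < #{r ∈ U | r < q} := by
      intro U p q hpU hpq
      apply Finset.card_lt_card
      rw [Finset.ssubset_iff_of_subset]
      · exact ⟨p, by simp [hpU, hpq], by simp⟩
      · intro r hr
        simp only [Finset.mem_filter] at hr ⊢
        exact ⟨hr.1, hr.2.trans hpq⟩
    intro U p q hpU hqU h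
    rcases lt_trichotomy p q with h' | h' | h'
    · have := aux U p q hpU h'; omega
    · exact h'
    · have := aux U q p hqU h'; omega
  have main : ∀ m, (m ∈ T ↔ m ∈ T') := by
    intro m
    induction m using Nat.strong_induction_on with
    | _ m ih =>
      have rk : ∀ p, p ≤ m → #{r ∈ T | r < p} = #{r ∈ T' | r < p} := by
        intro p hpm
        congr 1
        ext r
        simp only [Finset.mem_filter]
        constructor
        · rintro ⟨a, b⟩; exact ⟨(ih r (by omega)).1 a, b⟩
        · rintro ⟨a, b⟩; exact ⟨(ih r (by omega)).2 a, b⟩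
      rcases Nat.lt_or_ge m 2 with hm | hm
      · have : m = 0 ∨ m = 1 := by omega
        rcases this with rfl | rfl
        · constructor
          · intro h; have := h0 0 h; omega
          · intro h; have := h0' 0 h; omega
        · exact ⟨fun _ => h1', fun _ => h1⟩
      · constructor
        · intro h
          obtain ⟨m', hm', hm2, he⟩ := (hsub _).1 ⟨m, h, hm, rfl⟩
          rw [rk (m / 2) (by omega)] at he
          have e1 : m % 2 = m' % 2 := by omega
          have e2 := rank_inj T' (m / 2) (m' / 2) ((ih _ (by omega)).1 (hp m h hm))
            (hp' m' hm' hm2) (by omega)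
          have : m = m' := by omega
          rwa [this]
        · intro h
          obtain ⟨m', hm', hm2, he⟩ := (hsub _).2 ⟨m, h, hm, rfl⟩
          rw [← rk (m / 2) (by omega)] at he
          have e1 : m % 2 = m' % 2 := by omega
          have e2 := rank_inj T (m / 2) (m' / 2) ((ih _ (by omega)).2 (hp' m h hm))
            (hp m' hm' hm2) (by omega)
          have : m = m' := by omega
          rwa [this]
  ext m
  exact main m

/-- rooted subtrees with at most `m` nodes -/
def trees (d m : ℕ) : Finset (Finset ℕ) :=
  ((Finset.Icc 1 d).powerset).filter
    (fun T => 1 ∈ T ∧ (∀ i ∈ T, 2 ≤ i → i / 2 ∈ T) ∧ T.card ≤ m)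

lemma card_trees (d m : ℕ) : (trees d m).card ≤ 4 ^ m := by
  have : (4:ℕ) ^ m = ((Finset.range (2 * m)).powerset).card := by
    rw [Finset.card_powerset, Finset.card_range, pow_mul]; norm_num
  rw [this]
  apply Finset.card_le_card_of_injOn
    (fun T => (T.filter (2 ≤ ·)).image (fun m => 2 * #{q ∈ T | q < m / 2} + m % 2))
  · intro T hT
    simp only [trees, Finset.coe_filter, Finset.mem_powerset, Set.mem_ofPred_eq] at hT
    obtain ⟨hs, h1, hp, hc⟩ := hT
    simp only [Finset.coe_powerset, Set.mem_preimage, Set.mem_powerset_iff, Finset.coe_subset]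
    intro c hc'
    simp only [Finset.mem_image, Finset.mem_filter, Finset.mem_range] at hc' ⊢
    obtain ⟨i, ⟨hi, hi2⟩, rfl⟩ := hc'
    have : #{q ∈ T | q < i / 2} < T.card := by
      apply Finset.card_lt_card
      rw [Finset.ssubset_iff_of_subset (Finset.filter_subset _ _)]
      exact ⟨i / 2, hp i hi hi2, by simp⟩
    omega
  · intro T hT T' hT' he
    simp only [trees, Finset.coe_filter, Finset.mem_powerset, Set.mem_ofPred_eq] at hT hT'
    obtain ⟨hs, h1, hp, hc⟩ := hT
    obtain ⟨hs', h1', hp', hc'⟩ := hT'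
    apply code_inj h1 h1' (fun i hi => (Finset.mem_Icc.1 (hs hi)).1)
      (fun i hi => (Finset.mem_Icc.1 (hs' hi)).1) hp hp'
    intro c
    have := Finset.ext_iff.1 he c
    simp only [Finset.mem_image, Finset.mem_filter] at this
    constructor
    · rintro ⟨m, a, b, e⟩
      obtain ⟨m', ⟨a', b'⟩, e'⟩ := this.1 ⟨m, ⟨a, b⟩, e.symm⟩
      exact ⟨m', a', b', e'.symm⟩
    · rintro ⟨m, a, b, e⟩
      obtain ⟨m', ⟨a', b'⟩, e'⟩ := this.2 ⟨m, ⟨a, b⟩, e.symm⟩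
      exact ⟨m', a', b', e'.symm⟩

/-- integer vectors supported on `S` with bounded `ℓ¹` norm -/
def netS {d : ℕ} (S : Finset (Fin d)) (R : ℕ) : Finset (Fin d → ℤ) :=
  (Fintype.piFinset (fun i => if i ∈ S then Finset.Icc (-(R:ℤ)) R else {0})).filter
    (fun z => ∑ i, (z i).natAbs ≤ R)

lemma mem_netS {d : ℕ} (S : Finset (Fin d)) (R : ℕ) (z : Fin d → ℤ)
    (hz : ∀ i, i ∉ S → z i = 0) (hR : ∑ i, (z i).natAbs ≤ R) : z ∈ netS S R := by
  simp only [netS, Finset.mem_filter, Fintype.mem_piFinset]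
  refine ⟨fun i => ?_, hR⟩
  split_ifs with h
  · have : (z i).natAbs ≤ ∑ i, (z i).natAbs :=
      Finset.single_le_sum (f := fun i => (z i).natAbs) (fun _ _ => Nat.zero_le _) (Finset.mem_univ i)
    rw [Finset.mem_Icc]; omega
  · simp [hz i h]

lemma geom_Icc (R : ℕ) :
    ∑ z ∈ Finset.Icc (-(R:ℤ)) R, (1 / 2 : ℝ) ^ z.natAbs = 3 - 2 * (1 / 2 : ℝ) ^ R := by
  induction R with
  | zero => norm_num
  | succ R ih =>
    have : Finset.Icc (-((R + 1 : ℕ):ℤ)) ((R + 1 : ℕ):ℤ) =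
        insert (-((R + 1 : ℕ):ℤ)) (insert ((R + 1 : ℕ):ℤ) (Finset.Icc (-(R:ℤ)) R)) := by
      ext z; simp only [Finset.mem_insert, Finset.mem_Icc]; omega
    rw [this, Finset.sum_insert, Finset.sum_insert, ih]
    · rw [Int.natAbs_neg, Int.natAbs_natCast, pow_succ]; ring
    · simp only [Finset.mem_Icc]; omega
    · simp only [Finset.mem_insert, Finset.mem_Icc]; omega

lemma card_netS {d : ℕ} (S : Finset (Fin d)) (R : ℕ) :
    ((netS S R).card : ℝ) ≤ 2 ^ R * 3 ^ S.card := by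
  have h1 : ((netS S R).card : ℝ) * (1 / 2) ^ R ≤
      ∑ z ∈ Fintype.piFinset (fun i => if i ∈ S then Finset.Icc (-(R:ℤ)) R else {0}),
        ∏ i, (1 / 2 : ℝ) ^ (z i).natAbs := by
    calc ((netS S R).card : ℝ) * (1 / 2) ^ R = ∑ z ∈ netS S R, (1 / 2 : ℝ) ^ R := by simp
      _ ≤ ∑ z ∈ netS S R, ∏ i, (1 / 2 : ℝ) ^ (z i).natAbs := by
          apply Finset.sum_le_sum
          intro z hz
          rw [Finset.prod_pow_eq_pow_sum]
          apply pow_le_pow_of_le_one (by norm_num) (by norm_num)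
          exact (Finset.mem_filter.1 hz).2
      _ ≤ _ := by
          apply Finset.sum_le_sum_of_subset_of_nonneg (Finset.filter_subset _ _)
          intros; positivity
  rw [← Finset.prod_univ_sum (fun i => if i ∈ S then Finset.Icc (-(R:ℤ)) R else {0})
    (fun _ z => (1 / 2 : ℝ) ^ z.natAbs)] at h1
  have h2 : ∏ i, ∑ z ∈ (if i ∈ S then Finset.Icc (-(R:ℤ)) R else {0}), (1 / 2 : ℝ) ^ z.natAbs ≤
      ∏ i : Fin d, (if i ∈ S then (3:ℝ) else 1) := by
    apply Finset.prod_le_prod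
    · intros; positivity
    · intro i _
      split_ifs
      · rw [geom_Icc]; have : (0:ℝ) ≤ (1 / 2) ^ R := by positivity
        linarith
      · simp
  have h3 : ∏ i : Fin d, (if i ∈ S then (3:ℝ) else 1) = 3 ^ S.card := by
    simp [Finset.prod_ite]
  have h4 := (h1.trans h2).trans_eq h3
  have h5 : ((netS S R).card : ℝ) = 2 ^ R * ((netS S R).card * (1 / 2) ^ R) := by
    rw [mul_left_comm, ← mul_pow]; norm_num
  rw [h5]
  gcongr

lemma ip_eq {d : ℕ} (u v : Fin d → ℝ) : ip u v = u ⬝ᵥ v := rfl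

lemma ip_self_nonneg {d : ℕ} (u : Fin d → ℝ) : 0 ≤ ip u u :=
  Finset.sum_nonneg fun i _ => mul_self_nonneg (u i)

lemma nrm_sq {d : ℕ} (u : Fin d → ℝ) : nrm u ^ 2 = ip u u := by
  rw [nrm, Real.sq_sqrt (Finset.sum_nonneg fun i _ => sq_nonneg (u i)), ip]
  exact Finset.sum_congr rfl fun i _ => sq (u i)

lemma nrm_nonneg {d : ℕ} (u : Fin d → ℝ) : 0 ≤ nrm u := Real.sqrt_nonneg _

lemma ip_sq_le {d : ℕ} (u v : Fin d → ℝ) : ip u v ^ 2 ≤ ip u u * ip v v := by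
  have := Finset.sum_mul_sq_le_sq_mul_sq Finset.univ u v
  simpa only [ip, ← sq] using this

lemma ip_le {d : ℕ} (u v : Fin d → ℝ) : ip u v ≤ nrm u * nrm v := by
  apply le_of_sq_le_sq _ (mul_nonneg (nrm_nonneg u) (nrm_nonneg v))
  rw [mul_pow, nrm_sq, nrm_sq]
  exact ip_sq_le u v

/-- Rounding. -/
lemma rounding {d : ℕ} (S : Finset (Fin d)) (m : ℕ) (hm : 0 < m) (hS : S.card ≤ m)
    (L : ℝ) (hL : 0 < L) (hL2 : L ^ 2 = 16 * m)
    (a : Fin d → ℝ) (ha : ∀ i, i ∉ S → a i = 0) (ha1 : ip a a ≤ 1) :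
    ∃ z : Fin d → ℤ, (∀ i, i ∉ S → z i = 0) ∧ ∑ i, (z i).natAbs ≤ 16 * m ∧
      ip (fun i => (z i : ℝ)) (fun i => (z i : ℝ)) ≤ 16 * m ∧
      ip ((4:ℝ) • (a - L⁻¹ • fun i => (z i : ℝ))) ((4:ℝ) • (a - L⁻¹ • fun i => (z i : ℝ))) ≤ 1 := by
  have hr : ∀ y : ℝ, ∃ z : ℤ, (z : ℝ) ^ 2 ≤ y ^ 2 ∧ (y - z) ^ 2 ≤ 1 ∧ (y = 0 → z = 0) := by
    intro y
    rcases le_total 0 y with h | h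
    · refine ⟨⌊y⌋, ?_, ?_, ?_⟩
      · have h1 := Int.floor_le y
        have h2 : (0:ℝ) ≤ ⌊y⌋ := by exact_mod_cast Int.floor_nonneg.2 h
        nlinarith
      · have h1 := Int.floor_le y
        have h2 := Int.lt_floor_add_one y
        nlinarith
      · rintro rfl; simp
    · refine ⟨⌈y⌉, ?_, ?_, ?_⟩
      · have h1 := Int.le_ceil y
        have h2 : (⌈y⌉:ℝ) ≤ 0 := by exact_mod_cast Int.ceil_le.2 (by simpa using h)
        nlinarith
      · have h1 := Int.le_ceil y
        have h2 := Int.ceil_lt_add_one y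
        nlinarith
      · rintro rfl; simp
  choose f hf1 hf2 hf3 using hr
  have hz0 : ∀ i, i ∉ S → f (L * a i) = 0 := fun i hi => hf3 _ (by rw [ha i hi, mul_zero])
  have hzz : ip (fun i => (f (L * a i) : ℝ)) (fun i => (f (L * a i) : ℝ)) ≤ 16 * m := by
    calc _ ≤ ∑ i, L ^ 2 * (a i * a i) := by
          apply Finset.sum_le_sum
          intro i _
          have := hf1 (L * a i)
          nlinarith
      _ = L ^ 2 * ip a a := by rw [← Finset.mul_sum]; rfl
      _ ≤ 16 * m := by rw [hL2]; nlinarith [(Nat.cast_nonneg m : (0:ℝ) ≤ m)]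
  refine ⟨fun i => f (L * a i), hz0, ?_, hzz, ?_⟩
  · have : ((∑ i, (f (L * a i)).natAbs : ℕ) : ℝ) ≤ 16 * m := by
      refine le_trans ?_ hzz
      push_cast
      apply Finset.sum_le_sum
      intro i _
      have : ((f (L * a i)).natAbs : ℤ) ≤ f (L * a i) * f (L * a i) := by
        rw [← Int.natAbs_mul_self' (f (L * a i))]
        exact_mod_cast Nat.le_mul_self _
      have h2 : (((f (L * a i)).natAbs : ℤ) : ℝ) ≤ ((f (L * a i) * f (L * a i) : ℤ) : ℝ) := by
        exact_mod_cast this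
      push_cast at h2
      simpa using h2
    exact_mod_cast this
  · have e : ∀ i, ((4:ℝ) • (a - L⁻¹ • fun i => (f (L * a i) : ℝ))) i *
        ((4:ℝ) • (a - L⁻¹ • fun i => (f (L * a i) : ℝ))) i =
        (m : ℝ)⁻¹ * (L * a i - f (L * a i)) ^ 2 := by
      intro i
      simp only [Pi.smul_apply, Pi.sub_apply, smul_eq_mul]
      have hm' : (m : ℝ) = L ^ 2 / 16 := by rw [hL2]; ring
      rw [hm']
      field_simp
      ring
    unfold ip
    simp only [e]
    rw [← Finset.mul_sum]
    have : ∑ i, (L * a i - f (L * a i)) ^ 2 ≤ (m:ℝ) := by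
      calc _ ≤ ∑ i, (if i ∈ S then (1:ℝ) else 0) := by
            apply Finset.sum_le_sum
            intro i _
            split_ifs with h
            · exact hf2 _
            · rw [hz0 i h, ha i h]; simp
        _ = S.card := by simp
        _ ≤ m := by exact_mod_cast hS
    have hm0 : (0:ℝ) < m := by exact_mod_cast hm
    rw [inv_mul_le_iff₀ hm0]; linarith

lemma net_bound {d : ℕ} (E : Matrix (Fin d) (Fin d) ℝ) (hE : Eᵀ = E)
    (S : Finset (Fin d)) (m : ℕ) (hm : 0 < m) (hS : S.card ≤ m) (η : ℝ) (hη : 0 ≤ η)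
    (hnet : ∀ z ∈ netS S (32 * m), |quad E (fun i => (z i : ℝ))| ≤
      η * ip (fun i => (z i : ℝ)) (fun i => (z i : ℝ)))
    (a b : Fin d → ℝ) (ha : ∀ i, i ∉ S → a i = 0) (hb : ∀ i, i ∉ S → b i = 0) :
    |ip a (E.mulVec b)| ≤ 2 * η * (nrm a * nrm b) := by
  obtain ⟨L, hL, hL2⟩ : ∃ L : ℝ, 0 < L ∧ L ^ 2 = 16 * m :=
    ⟨Real.sqrt (16 * m), by positivity, Real.sq_sqrt (by positivity)⟩
  have hm0 : (0:ℝ) < m := by exact_mod_cast hm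
  let V : ℝ → Prop := fun K => ∀ a b : Fin d → ℝ, (∀ i, i ∉ S → a i = 0) → (∀ i, i ∉ S → b i = 0) →
    ip a a ≤ 1 → ip b b ≤ 1 → |ip a (E.mulVec b)| ≤ K
  have hstep : ∀ K, V K → V (K / 2 + η) := by
    intro K hK a b ha hb ha1 hb1
    obtain ⟨z, hz0, hz1, hz2, hz3⟩ := rounding S m hm hS L hL hL2 a ha ha1
    obtain ⟨y, hy0, hy1, hy2, hy3⟩ := rounding S m hm hS L hL hL2 b hb hb1
    set Z : Fin d → ℝ := fun i => (z i : ℝ) with hZ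
    set Y : Fin d → ℝ := fun i => (y i : ℝ) with hY
    set a' := (4:ℝ) • (a - L⁻¹ • Z) with ha'
    set b' := (4:ℝ) • (b - L⁻¹ • Y) with hb'
    have hZ0 : ∀ i, i ∉ S → Z i = 0 := fun i hi => by simp [hZ, hz0 i hi]
    have hY0 : ∀ i, i ∉ S → Y i = 0 := fun i hi => by simp [hY, hy0 i hi]
    have k1 := hK a' b (fun i hi => by simp [ha', ha i hi, hZ0 i hi]) hb hz3 hb1
    have hLZ : ip (L⁻¹ • Z) (L⁻¹ • Z) ≤ 1 := by
      have : ip (L⁻¹ • Z) (L⁻¹ • Z) = (L ^ 2)⁻¹ * ip Z Z := by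
        simp only [ip_eq, smul_dotProduct, dotProduct_smul, smul_eq_mul]; ring
      rw [this, inv_mul_le_iff₀ (by positivity), hL2]; linarith
    have k2 := hK (L⁻¹ • Z) b' (fun i hi => by simp [hZ0 i hi])
      (fun i hi => by simp [hb', hb i hi, hY0 i hi]) hLZ hy3
    have n1 := hnet (z + y) (mem_netS _ _ _ (fun i hi => by simp [hz0 i hi, hy0 i hi]) (by
      calc _ ≤ ∑ i, ((z i).natAbs + (y i).natAbs) :=
            Finset.sum_le_sum fun i _ => Int.natAbs_add_le _ _
        _ ≤ _ := by rw [Finset.sum_add_distrib]; omega))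
    have n2 := hnet (z - y) (mem_netS _ _ _ (fun i hi => by simp [hz0 i hi, hy0 i hi]) (by
      calc _ ≤ ∑ i, ((z i).natAbs + (y i).natAbs) :=
            Finset.sum_le_sum fun i _ => Int.natAbs_sub_le _ _
        _ ≤ _ := by rw [Finset.sum_add_distrib]; omega))
    have c1 : (fun i => (((z + y) i : ℤ) : ℝ)) = Z + Y := by ext i; simp [hZ, hY]
    have c2 : (fun i => (((z - y) i : ℤ) : ℝ)) = Z - Y := by ext i; simp [hZ, hY]
    rw [c1] at n1
    rw [c2] at n2
    have hsym : ip Y (E.mulVec Z) = ip Z (E.mulVec Y) := by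
      rw [ip_eq, ip_eq, dotProduct_mulVec, ← mulVec_transpose, hE, dotProduct_comm]
    have q1 : quad E (Z + Y) = quad E Z + quad E Y + 2 * ip Z (E.mulVec Y) := by
      have : quad E (Z + Y) = quad E Z + quad E Y + ip Z (E.mulVec Y) + ip Y (E.mulVec Z) := by
        simp only [quad, ip_eq, mulVec_add, dotProduct_add, add_dotProduct]; ring
      rw [this, hsym]; ring
    have q2 : quad E (Z - Y) = quad E Z + quad E Y - 2 * ip Z (E.mulVec Y) := by
      have : quad E (Z - Y) = quad E Z + quad E Y - ip Z (E.mulVec Y) - ip Y (E.mulVec Z) := by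
        simp only [quad, ip_eq, mulVec_sub, dotProduct_sub, sub_dotProduct]; ring
      rw [this, hsym]; ring
    have p1 : ip (Z + Y) (Z + Y) + ip (Z - Y) (Z - Y) = 2 * ip Z Z + 2 * ip Y Y := by
      simp only [ip_eq, dotProduct_sub, sub_dotProduct, dotProduct_add, add_dotProduct]; ring
    have hZY : |ip Z (E.mulVec Y)| ≤ η * (16 * m) := by
      rw [q1] at n1
      rw [q2] at n2
      have := abs_le.1 n1
      have := abs_le.1 n2
      have : η * (ip (Z + Y) (Z + Y) + ip (Z - Y) (Z - Y)) ≤ η * (64 * m) := by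
        rw [p1]; gcongr; linarith
      rw [abs_le]; constructor <;> linarith
    have k3 : |ip (L⁻¹ • Z) (E.mulVec (L⁻¹ • Y))| ≤ η := by
      have : ip (L⁻¹ • Z) (E.mulVec (L⁻¹ • Y)) = (L ^ 2)⁻¹ * ip Z (E.mulVec Y) := by
        simp only [ip_eq, mulVec_smul, smul_dotProduct, dotProduct_smul, smul_eq_mul]; ring
      rw [this, abs_mul, abs_of_pos (by positivity), inv_mul_le_iff₀ (by positivity), hL2]
      linarith
    have dec : ip a (E.mulVec b) = ip (L⁻¹ • Z) (E.mulVec (L⁻¹ • Y)) + 1 / 4 * ip a' (E.mulVec b) +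
        1 / 4 * ip (L⁻¹ • Z) (E.mulVec b') := by
      simp only [ha', hb', ip_eq, mulVec_smul, mulVec_sub, smul_dotProduct, dotProduct_smul,
        smul_eq_mul, dotProduct_sub, sub_dotProduct]
      ring
    rw [dec]
    have := abs_le.1 k1
    have := abs_le.1 k2
    have := abs_le.1 k3
    rw [abs_le]; constructor <;> linarith
  obtain ⟨K, hK0, hK⟩ : ∃ K, 0 ≤ K ∧ V K := by
    refine ⟨∑ i, ∑ j, |E i j|, by positivity, ?_⟩
    intro a b _ _ ha1 hb1
    have co : ∀ (u : Fin d → ℝ), ip u u ≤ 1 → ∀ i, |u i| ≤ 1 := by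
      intro u hu i
      have : u i * u i ≤ ip u u :=
        Finset.single_le_sum (f := fun i => u i * u i) (fun i _ => mul_self_nonneg _) (Finset.mem_univ i)
      rw [abs_le_one_iff_mul_self_le_one]; linarith
    have : ip a (E.mulVec b) = ∑ i, ∑ j, a i * (E i j * b j) := by
      simp only [ip, mulVec, dotProduct, Finset.mul_sum]
    rw [this]
    refine (Finset.abs_sum_le_sum_abs _ _).trans (Finset.sum_le_sum fun i _ => ?_)
    refine (Finset.abs_sum_le_sum_abs _ _).trans (Finset.sum_le_sum fun j _ => ?_)
    rw [abs_mul, abs_mul]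
    have := co a ha1 i
    have := co b hb1 j
    calc |a i| * (|E i j| * |b j|) ≤ 1 * (|E i j| * 1) := by gcongr
      _ = _ := by ring
  have hiter : ∀ N : ℕ, V (2 * η + K * (1 / 2) ^ N) := by
    intro N
    induction N with
    | zero => intro a b h1 h2 h3 h4; have := hK a b h1 h2 h3 h4; simp; linarith
    | succ N ih =>
      have := hstep _ ih
      rw [pow_succ]
      convert this using 1
      ring
  have hV : V (2 * η) := by
    intro a b h1 h2 h3 h4
    have lim : Filter.Tendsto (fun N : ℕ => 2 * η + K * (1 / 2 : ℝ) ^ N) Filter.atTop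
        (nhds (2 * η + K * 0)) :=
      ((tendsto_pow_atTop_nhds_zero_of_lt_one (by norm_num) (by norm_num)).const_mul K).const_add _
    rw [mul_zero, add_zero] at lim
    exact ge_of_tendsto' lim fun N => hiter N a b h1 h2 h3 h4
  have zero_of : ∀ u : Fin d → ℝ, nrm u = 0 → u = 0 := by
    intro u hu
    have h := nrm_sq u
    rw [hu] at h
    have : u ⬝ᵥ u = 0 := by rw [← ip_eq, ← h]; norm_num
    exact dotProduct_self_eq_zero.1 this
  rcases (nrm_nonneg a).eq_or_lt with h | h
  · rw [zero_of a h.symm]; simp [ip_eq]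
    have := nrm_nonneg (0 : Fin d → ℝ)
    have := nrm_nonneg b
    positivity
  rcases (nrm_nonneg b).eq_or_lt with h' | h'
  · rw [zero_of b h'.symm]; simp [ip_eq]
    have := nrm_nonneg (0 : Fin d → ℝ)
    positivity
  have unit : ∀ u : Fin d → ℝ, 0 < nrm u → ip ((nrm u)⁻¹ • u) ((nrm u)⁻¹ • u) ≤ 1 := by
    intro u hu
    simp only [ip_eq, smul_dotProduct, dotProduct_smul, smul_eq_mul]
    rw [← ip_eq, ← nrm_sq]
    field_simp
    rfl
  have := hV ((nrm a)⁻¹ • a) ((nrm b)⁻¹ • b) (fun i hi => by simp [ha i hi])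
    (fun i hi => by simp [hb i hi]) (unit a h) (unit b h')
  have e : ip ((nrm a)⁻¹ • a) (E.mulVec ((nrm b)⁻¹ • b)) =
      (nrm a * nrm b)⁻¹ * ip a (E.mulVec b) := by
    simp only [ip_eq, mulVec_smul, smul_dotProduct, dotProduct_smul, smul_eq_mul, mul_inv]; ring
  rw [e, abs_mul, abs_of_pos (by positivity), inv_mul_le_iff₀ (by positivity)] at this
  linarith

lemma quad_cov {d n : ℕ} {Ω : Type*} (lam : ℝ) (vstar : Fin d → ℝ)
    (x : Fin n → Ω → Fin d → ℝ) (ω : Ω) (w : Fin d → ℝ) :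
    quad (sampleCov x ω - spikedCov lam vstar) w =
      (n : ℝ)⁻¹ * ∑ i, ip (x i ω) w ^ 2 - (lam * ip vstar w ^ 2 + ip w w) := by
  have h1 : ∀ u : Fin d → ℝ, w ⬝ᵥ (vecMulVec u u).mulVec w = (u ⬝ᵥ w) ^ 2 := by
    intro u
    rw [vecMulVec_mulVec, dotProduct_comm w]
    simp [smul_dotProduct, sq]
  simp only [quad, ip_eq, sampleCov, spikedCov, sub_mulVec, add_mulVec, smul_mulVec, one_mulVec,
    dotProduct_sub, dotProduct_add, dotProduct_smul, smul_eq_mul, h1, sum_mulVec, dotProduct_sum]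

lemma cov_symm {d n : ℕ} {Ω : Type*} (lam : ℝ) (vstar : Fin d → ℝ)
    (x : Fin n → Ω → Fin d → ℝ) (ω : Ω) :
    (sampleCov x ω - spikedCov lam vstar)ᵀ = sampleCov x ω - spikedCov lam vstar := by
  simp only [sampleCov, spikedCov, transpose_sub, transpose_add, transpose_smul, transpose_one,
    transpose_sum, transpose_vecMulVec]

lemma quad_tail {d n : ℕ} {Ω : Type*} [MeasurableSpace Ω] {μ : Measure Ω} [IsProbabilityMeasure μ]
    (lam : ℝ) (hlam : 0 ≤ lam) (hn : 0 < n) (vstar : Fin d → ℝ) (hv : nrm vstar = 1)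
    (x : Fin n → Ω → Fin d → ℝ) (hx : IsSpikedWishart μ lam vstar x)
    {s : ℝ} (hs : 0 ≤ s) (hs1 : s ≤ 1 / 2) (w : Fin d → ℝ) :
    μ.real {ω | s * (1 + lam) * ip w w < |quad (sampleCov x ω - spikedCov lam vstar) w|} ≤
      2 * Real.exp (-(n * s ^ 2 / 8)) := by
  obtain ⟨G, hm, hi, hG, hxG⟩ := hx
  have hn0 : (0:ℝ) < n := by exact_mod_cast hn
  rcases (ip_self_nonneg w).eq_or_lt with h0 | hw
  · have : w = 0 := dotProduct_self_eq_zero.1 h0.symm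
    subst this
    have : {ω | s * (1 + lam) * ip (0 : Fin d → ℝ) 0 <
        |quad (sampleCov x ω - spikedCov lam vstar) 0|} = ∅ := by
      ext ω; simp [quad, ip_eq]
    rw [this]; simp; positivity
  have hs2 : 0 < lam * ip vstar w ^ 2 + ip w w := by positivity
  obtain ⟨σ, hσ, hσ2⟩ : ∃ σ : ℝ, 0 < σ ∧ σ ^ 2 = lam * ip vstar w ^ 2 + ip w w :=
    ⟨Real.sqrt _, Real.sqrt_pos.2 hs2, Real.sq_sqrt hs2.le⟩
  have hle : σ ^ 2 ≤ (1 + lam) * ip w w := by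
    have := ip_sq_le vstar w
    rw [← nrm_sq vstar, hv] at this
    rw [hσ2]; nlinarith
  let c : Fin n → (Fin n ⊕ Fin n × Fin d) → ℝ := fun i p =>
    Sum.elim (fun i' => if i = i' then Real.sqrt lam * ip vstar w / σ else 0)
      (fun q => if i = q.1 then w q.2 / σ else 0) p
  have hc : ∀ i j, ∑ p, c i p * c j p = if i = j then 1 else 0 := by
    intro i j
    rw [Fintype.sum_sum_type, Fintype.sum_prod_type]
    simp only [c, Sum.elim_inl, Sum.elim_inr]
    by_cases hij : i = j
    · subst hij
      simp only [if_true, mul_ite, mul_zero, ite_mul, zero_mul]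
      have : ∀ q : Fin n, ∑ r : Fin d, (if i = q then (if i = q then w r / σ * (w r / σ) else 0) else 0)
          = if i = q then ip w w / σ ^ 2 else 0 := by
        intro q
        split_ifs
        · rw [ip, Finset.sum_div]
          exact Finset.sum_congr rfl fun r _ => by rw [div_mul_div_comm, sq]
        · simp
      simp only [this]
      simp only [Finset.sum_ite_eq, Finset.mem_univ, if_true]
      rw [div_mul_div_comm, mul_mul_mul_comm, Real.mul_self_sqrt hlam, ← sq, ← sq, ← add_div, hσ2]
      exact div_self hs2.ne'
    · rw [if_neg hij]
      have : ∀ q, ¬ (i = q ∧ j = q) := by rintro q ⟨rfl, h⟩; exact hij h.symm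
      rw [Finset.sum_eq_zero, Finset.sum_eq_zero, add_zero]
      · intro q _
        apply Finset.sum_eq_zero
        intro r _
        by_cases h : i = q
        · have : j ≠ q := fun h' => this q ⟨h, h'⟩
          simp [this]
        · simp [h]
      · intro q _
        by_cases h : i = q
        · have : j ≠ q := fun h' => this q ⟨h, h'⟩
          simp [this]
        · simp [h]
  obtain ⟨hYi, hY⟩ := gauss_lin G hm hi hG c hc
  have hYx : ∀ i ω, ∑ p, c i p * G p ω = ip (x i ω) w / σ := by
    intro i ω
    rw [Fintype.sum_sum_type, Fintype.sum_prod_type]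
    simp only [c, Sum.elim_inl, Sum.elim_inr, ite_mul, zero_mul]
    rw [Finset.sum_comm]
    simp only [Finset.sum_ite_eq, Finset.mem_univ, if_true, ip, hxG]
    rw [Finset.sum_div, Finset.mul_sum, Finset.sum_div, Finset.sum_mul, ← Finset.sum_add_distrib]
    exact Finset.sum_congr rfl fun j _ => by ring
  have ht := chi_tail (fun i ω => ∑ p, c i p * G p ω)
    (fun i => Finset.measurable_sum _ fun p _ => (hm p).const_mul _) hYi hY hs hs1
  refine (measureReal_mono ?_).trans ht
  intro ω hω
  simp only [Set.mem_ofPred_eq] at hω ⊢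
  simp only [hYx]
  have e : quad (sampleCov x ω - spikedCov lam vstar) w =
      σ ^ 2 * (n:ℝ)⁻¹ * ∑ i, ((ip (x i ω) w / σ) ^ 2 - 1) := by
    rw [quad_cov, ← hσ2, Finset.sum_sub_distrib]
    simp only [div_pow, ← Finset.sum_div]
    simp
    field_simp
  rw [e, abs_mul, abs_of_pos (by positivity)] at hω
  have h1 : s * σ ^ 2 ≤ s * (1 + lam) * ip w w := by rw [mul_assoc]; gcongr
  have h2 := h1.trans_lt hω
  have h3 : σ ^ 2 * (s * n) < σ ^ 2 * |∑ i, ((ip (x i ω) w / σ) ^ 2 - 1)| := by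
    have := mul_lt_mul_of_pos_right h2 hn0
    calc _ = s * σ ^ 2 * n := by ring
      _ < _ := this
      _ = _ := by field_simp
  have := lt_of_mul_lt_mul_left h3 (by positivity)
  linarith

/-- coordinates of a set of nodes -/
def coords (d : ℕ) (T : Finset ℕ) : Finset (Fin d) :=
  Finset.univ.filter (fun i => (i : ℕ) + 1 ∈ T)

lemma card_coords (d : ℕ) (T : Finset ℕ) : (coords d T).card ≤ T.card := by
  apply Finset.card_le_card_of_injOn (fun i : Fin d => (i : ℕ) + 1)
  · intro i hi
    simpa [coords] using hi
  · intro i _ j _ h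
    ext; simpa using h

def fullNet (d k : ℕ) : Finset (Fin d → ℤ) :=
  (trees d (3 * k)).biUnion (fun T => netS (coords d T) (32 * (3 * k)))

lemma card_fullNet (d k : ℕ) : ((fullNet d k).card : ℝ) ≤ 2 ^ (108 * k) := by
  have h1 : ((fullNet d k).card : ℝ) ≤
      ∑ T ∈ trees d (3 * k), ((netS (coords d T) (32 * (3 * k))).card : ℝ) := by
    exact_mod_cast Finset.card_biUnion_le
  have h2 : ∀ T ∈ trees d (3 * k), ((netS (coords d T) (32 * (3 * k))).card : ℝ) ≤
      2 ^ (32 * (3 * k)) * 3 ^ (3 * k) := by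
    intro T hT
    refine (card_netS _ _).trans ?_
    gcongr
    · norm_num
    · refine (card_coords d T).trans ?_
      simp only [trees, Finset.mem_filter] at hT
      exact hT.2.2.2
  calc _ ≤ _ := h1
    _ ≤ ∑ T ∈ trees d (3 * k), (2:ℝ) ^ (32 * (3 * k)) * 3 ^ (3 * k) := Finset.sum_le_sum h2
    _ = (trees d (3 * k)).card * ((2:ℝ) ^ (32 * (3 * k)) * 3 ^ (3 * k)) := by simp
    _ ≤ 4 ^ (3 * k) * ((2:ℝ) ^ (32 * (3 * k)) * 4 ^ (3 * k)) := by
        gcongr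
        · exact_mod_cast card_trees d (3 * k)
        · norm_num
    _ = _ := by
        rw [show (4:ℝ) = 2 ^ 2 by norm_num, ← pow_mul, ← pow_add, ← pow_add]
        congr 1; ring

lemma union_tree {d k : ℕ} {T1 T2 T3 : Finset ℕ} (h1 : IsTreeSet d k T1) (h2 : IsTreeSet d k T2)
    (h3 : IsTreeSet d k T3) : T1 ∪ T2 ∪ T3 ∈ trees d (3 * k) := by
  simp only [trees, Finset.mem_filter, Finset.mem_powerset]
  obtain ⟨c1, r1, b1, p1⟩ := h1
  obtain ⟨c2, r2, b2, p2⟩ := h2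
  obtain ⟨c3, r3, b3, p3⟩ := h3
  refine ⟨?_, by simp [r1], ?_, ?_⟩
  · intro i hi
    simp only [Finset.mem_union] at hi
    rw [Finset.mem_Icc]
    rcases hi with (hi | hi) | hi
    · exact b1 i hi
    · exact b2 i hi
    · exact b3 i hi
  · intro i hi hi2
    simp only [Finset.mem_union] at hi ⊢
    rcases hi with (hi | hi) | hi
    · exact Or.inl (Or.inl (p1 i hi hi2))
    · exact Or.inl (Or.inr (p2 i hi hi2))
    · exact Or.inr (p3 i hi hi2)
  · have := Finset.card_union_le (T1 ∪ T2) T3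
    have := Finset.card_union_le T1 T2
    omega

lemma sub_sq {d : ℕ} (u v : Fin d → ℝ) (hu : nrm u = 1) (hv : nrm v = 1) :
    nrm (u - v) ^ 2 = 2 - 2 * ip u v := by
  have h1 := nrm_sq u
  have h2 := nrm_sq v
  rw [hu] at h1
  rw [hv] at h2
  have : ip (u - v) (u - v) = ip u u + ip v v - 2 * ip u v := by
    simp only [ip_eq, dotProduct_sub, sub_dotProduct]
    rw [dotProduct_comm v u]; ring
  rw [nrm_sq, this, ← h1, ← h2]; ring

/-- one step of the power method -/
lemma one_step {d : ℕ} (lam s : ℝ) (hlam : 8 ≤ lam) (hs : 0 ≤ s)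
    (A : Matrix (Fin d) (Fin d) ℝ) (vstar v u : Fin d → ℝ)
    (hvs : nrm vstar = 1) (hv : nrm v = 1) (hu : nrm u = 1)
    (hopt : ip vstar (A.mulVec v) ≤ ip u (A.mulVec v))
    (hE : |ip (u - vstar) ((A - spikedCov lam vstar).mulVec v)| ≤
      2 * (s * (1 + lam)) * (nrm (u - vstar) * nrm v))
    (hclose : nrm (v - vstar) ≤ 1) :
    nrm (u - vstar) ≤ 1 / 2 * nrm (v - vstar) + 16 * s := by
  set e := nrm (u - vstar) with he
  set f := nrm (v - vstar) with hf
  have he0 : 0 ≤ e := nrm_nonneg _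
  have hf0 : 0 ≤ f := nrm_nonneg _
  have e2 := sub_sq u vstar hu hvs
  have f2 := sub_sq v vstar hv hvs
  rw [← he] at e2
  rw [← hf] at f2
  have ha : 1 / 2 ≤ ip v vstar := by nlinarith
  have hE' := (abs_le.1 hE).2
  rw [hv, mul_one] at hE'
  have hcs := ip_le (u - vstar) (v - vstar)
  rw [← he, ← hf] at hcs
  have hvv : ip vstar vstar = 1 := by rw [← nrm_sq, hvs]; norm_num
  have dec : ip (u - vstar) ((A - spikedCov lam vstar).mulVec v) =
      ip u (A.mulVec v) - ip vstar (A.mulVec v) -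
        lam * ip v vstar * (ip u vstar - ip vstar vstar) - ip (u - vstar) v := by
    simp only [ip_eq, spikedCov, sub_mulVec, add_mulVec, smul_mulVec, one_mulVec, vecMulVec_mulVec,
      dotProduct_sub, sub_dotProduct, dotProduct_add, dotProduct_smul, smul_eq_mul]
    simp
    rw [dotProduct_comm vstar v]
    ring
  have dec2 : ip (u - vstar) v = ip (u - vstar) (v - vstar) + ip u vstar - ip vstar vstar := by
    simp only [ip_eq, dotProduct_sub, sub_dotProduct]; ring
  rw [dec, dec2, hvv] at hE'
  have h1 : lam * ip v vstar * (e ^ 2 / 2) ≤ e * f + 2 * (s * (1 + lam)) * e := by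
    have hiu : ip u vstar = 1 - e ^ 2 / 2 := by linarith
    rw [hiu] at hE'
    nlinarith [sq_nonneg e]
  have h2 : lam * (1 / 2) * (e ^ 2 / 2) ≤ lam * ip v vstar * (e ^ 2 / 2) := by gcongr
  rcases he0.eq_or_lt with h | h
  · rw [← h]; positivity
  have h3 : lam * e ≤ 4 * f + 8 * (s * (1 + lam)) := by
    have : e * (lam * e) ≤ e * (4 * f + 8 * (s * (1 + lam))) := by nlinarith
    exact le_of_mul_le_mul_left this h
  have h4 : lam * e ≤ lam * (1 / 2 * f + 16 * s) := by nlinarith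
  exact le_of_mul_le_mul_left h4 (by linarith)

lemma iterate_bound (f : ℕ → ℝ) (s : ℝ) (hs1 : s ≤ 1 / 32) (h0 : f 0 ≤ 1)
    (hstep : ∀ t, f t ≤ 1 → f (t + 1) ≤ 1 / 2 * f t + 16 * s) :
    ∀ t, f t ≤ 1 ∧ f t ≤ (1 / 2) ^ t * f 0 + 32 * s * (1 - (1 / 2) ^ t) := by
  intro t
  induction t with
  | zero => simp [h0]
  | succ t ih =>
    have := hstep t ih.1
    refine ⟨by linarith [ih.1], ?_⟩
    rw [pow_succ]
    linarith [ih.2]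

/-- Corollary 6: local convergence of the projected power method
for tree-sparse PCA, with high probability. -/
theorem tree_sparse_projected_power_method :
    ∃ c C1 C2 C3 : ℝ, 0 < c ∧ 0 < C1 ∧ 0 < C2 ∧ 0 < C3 ∧
      ∀ (h d k n : ℕ), d = 2 ^ h - 1 →
      ∀ lam : ℝ, C1 ≤ lam → C2 * k ≤ (n : ℝ) →
      ∀ vstar : Fin d → ℝ, TreeSparse d k vstar → nrm vstar = 1 →
      ∀ (Ω : Type) (_ : MeasurableSpace Ω) (μ : Measure Ω), IsProbabilityMeasure μ →
      ∀ x : Fin n → Ω → Fin d → ℝ, IsSpikedWishart μ lam vstar x →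
      ∀ (v0 : Fin d → ℝ), TreeSparse d k v0 → nrm v0 = 1 → 1 / 2 ≤ ip v0 vstar →
      ∀ v : ℕ → Ω → Fin d → ℝ,
        (∀ ω, v 0 ω = v0) →
        (∀ t ω, TreeSparse d k (v (t + 1) ω) ∧ nrm (v (t + 1) ω) = 1 ∧
          ∀ u : Fin d → ℝ, TreeSparse d k u → nrm u = 1 →
            ip u ((sampleCov x ω).mulVec (v t ω)) ≤
              ip (v (t + 1) ω) ((sampleCov x ω).mulVec (v t ω))) →
        ENNReal.ofReal (1 - Real.exp (-(c * k))) ≤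
          μ {ω | ∀ t : ℕ, 1 ≤ t →
            nrm (v t ω - vstar) ≤
              (1 / 2) ^ t * nrm (v0 - vstar) + C3 * Real.sqrt (k / n)} := by
  refine ⟨1, 8, 1000000, 1000, by norm_num, by norm_num, by norm_num, by norm_num, ?_⟩
  intro h d k n _ lam hlam hkn vstar hvT hvn Ω _ μ _ x hx v0 hv0T hv0n hv0 v hv_zero hv
  have hk : 0 < k := by
    obtain ⟨T, ⟨hc, h1, _⟩, _⟩ := hvT
    rw [← hc]; exact Finset.card_pos.2 ⟨1, h1⟩
  have hk0 : (0:ℝ) < k := by exact_mod_cast hk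
  have hn0 : (0:ℝ) < n := by linarith
  have hn : 0 < n := by exact_mod_cast hn0
  set s := Real.sqrt (880 * k / n) with hs
  have hs0 : 0 ≤ s := Real.sqrt_nonneg _
  have hs2 : s ^ 2 = 880 * k / n := Real.sq_sqrt (by positivity)
  have hs1 : s ≤ 1 / 32 := by
    rw [hs, Real.sqrt_le_left (by norm_num), div_le_iff₀ hn0]
    linarith
  have hs3 : 32 * s ≤ 1000 * Real.sqrt (k / n) := by
    have : s = Real.sqrt 880 * Real.sqrt (k / n) := by
      rw [hs, mul_div_assoc, Real.sqrt_mul (by norm_num)]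
    have h30 : Real.sqrt 880 ≤ 30 := by
      rw [Real.sqrt_le_left (by norm_num)]; norm_num
    have := Real.sqrt_nonneg ((k:ℝ) / n)
    nlinarith
  -- the bad event
  let bad : (Fin d → ℤ) → Set Ω := fun z =>
    {ω | s * (1 + lam) * ip (fun i => (z i : ℝ)) (fun i => (z i : ℝ)) <
      |quad (sampleCov x ω - spikedCov lam vstar) (fun i => (z i : ℝ))|}
  let B : Set Ω := ⋃ z ∈ fullNet d k, bad z
  have hB : μ.real B ≤ Real.exp (-(1 * k)) := by
    calc μ.real B ≤ ∑ z ∈ fullNet d k, μ.real (bad z) := measureReal_biUnion_finset_le _ _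
      _ ≤ ∑ z ∈ fullNet d k, 2 * Real.exp (-(n * s ^ 2 / 8)) :=
          Finset.sum_le_sum fun z _ =>
            quad_tail lam (by linarith) hn vstar hvn x hx hs0 (by linarith) _
      _ = (fullNet d k).card * (2 * Real.exp (-(n * s ^ 2 / 8))) := by simp
      _ ≤ Real.exp 1 ^ (108 * k) * (Real.exp 1 ^ k * Real.exp (-(n * s ^ 2 / 8))) := by
          have he : (2:ℝ) ≤ Real.exp 1 := by linarith [Real.add_one_le_exp (1:ℝ)]
          have h2 : (2:ℝ) ≤ Real.exp 1 ^ k := he.trans (le_self_pow₀ (by linarith) hk.ne')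
          have h3 : ((fullNet d k).card : ℝ) ≤ Real.exp 1 ^ (108 * k) :=
            (card_fullNet d k).trans (pow_le_pow_left₀ (by norm_num) he _)
          gcongr
      _ = Real.exp (-(1 * k)) := by
          rw [← Real.exp_nat_mul, ← Real.exp_nat_mul, ← Real.exp_add, ← Real.exp_add, hs2]
          congr 1
          push_cast
          field_simp
          ring
  have hgood : Bᶜ ⊆ {ω | ∀ t : ℕ, 1 ≤ t →
      nrm (v t ω - vstar) ≤
        (1 / 2) ^ t * nrm (v0 - vstar) + 1000 * Real.sqrt (k / n)} := by
    intro ω hω t ht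
    have hall : ∀ z ∈ fullNet d k,
        |quad (sampleCov x ω - spikedCov lam vstar) (fun i => (z i : ℝ))| ≤
          s * (1 + lam) * ip (fun i => (z i : ℝ)) (fun i => (z i : ℝ)) := by
      intro z hz
      by_contra hcon
      exact hω (Set.mem_biUnion hz (not_le.1 hcon))
    have hvt : ∀ t, TreeSparse d k (v t ω) ∧ nrm (v t ω) = 1 := by
      intro t
      cases t with
      | zero => rw [hv_zero]; exact ⟨hv0T, hv0n⟩
      | succ t => exact ⟨(hv t ω).1, (hv t ω).2.1⟩
    have hf0 : nrm (v 0 ω - vstar) ≤ 1 := by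
      rw [hv_zero]
      have := sub_sq v0 vstar hv0n hvn
      have := nrm_nonneg (v0 - vstar)
      nlinarith
    have hstep : ∀ t, nrm (v t ω - vstar) ≤ 1 →
        nrm (v (t + 1) ω - vstar) ≤ 1 / 2 * nrm (v t ω - vstar) + 16 * s := by
      intro t hcl
      apply one_step lam s hlam hs0 (sampleCov x ω) vstar (v t ω) (v (t + 1) ω) hvn (hvt t).2
        (hvt (t + 1)).2 ((hv t ω).2.2 vstar hvT hvn) _ hcl
      obtain ⟨T1, hT1, hs1⟩ := (hvt t).1
      obtain ⟨T2, hT2, hs2⟩ := (hvt (t + 1)).1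
      obtain ⟨T3, hT3, hs3⟩ := hvT
      have hU := union_tree hT1 hT2 hT3
      have hUc : (T1 ∪ T2 ∪ T3).card ≤ 3 * k := by
        simp only [trees, Finset.mem_filter] at hU
        exact hU.2.2.2
      apply net_bound _ (cov_symm lam vstar x ω) (coords d (T1 ∪ T2 ∪ T3)) (3 * k) (by omega)
        ((card_coords _ _).trans hUc) (s * (1 + lam)) (by apply mul_nonneg hs0; linarith)
      · intro z hz
        exact hall z (Finset.mem_biUnion.2 ⟨_, hU, hz⟩)
      · intro i hi
        simp only [coords, Finset.mem_filter, Finset.mem_univ, true_and, Finset.mem_union,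
          not_or] at hi
        have e1 : v (t + 1) ω i = 0 := by
          by_contra hc; exact hi.1.2 (hs2 i hc)
        have e2 : vstar i = 0 := by
          by_contra hc; exact hi.2 (hs3 i hc)
        simp [e1, e2]
      · intro i hi
        simp only [coords, Finset.mem_filter, Finset.mem_univ, true_and, Finset.mem_union,
          not_or] at hi
        by_contra hc; exact hi.1.1 (hs1 i hc)
    have := (iterate_bound (fun t => nrm (v t ω - vstar)) s hs1 hf0 hstep t).2
    simp only [hv_zero] at this
    have hp : (0:ℝ) ≤ (1 / 2) ^ t := by positivity
    have : 32 * s * (1 - (1 / 2) ^ t) ≤ 32 * s := by nlinarith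
    linarith
  refine le_trans ?_ (measure_mono hgood)
  have hBle : μ B ≤ ENNReal.ofReal (Real.exp (-(1 * k))) := by
    rw [← ofReal_measureReal (h := measure_ne_top μ B)]
    exact ENNReal.ofReal_le_ofReal hB
  have h1 : 1 ≤ μ B + μ Bᶜ := by
    rw [← measure_univ (μ := μ), ← Set.union_compl_self B]
    exact measure_union_le _ _
  rw [ENNReal.ofReal_sub _ (Real.exp_pos _).le, ENNReal.ofReal_one, tsub_le_iff_left]
  exact h1.trans (by gcongr)

end StructuredPCA
end
end
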